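/- arXiv:2003.01844 — 5 statements merged into one kernel-verified Lean document; each statement's English description precedes it below -/
import Mathlib

section
/- Lemma: If A and B ∈ ARI(Γ) are push-invariant, then swap(ari_u(A,B)) = ari_v(swap(A), swap(B)). -/
namespace KVMould

/-- A mould over `Γ` in evaluation form: the depth-`m` component
`M m σ x` is the value of the rational function `M^m_{σ₁,…,σₘ}` at the
rational point `x = (x₁,…,xₘ)` (indices are 0-based). -/
abbrev Mould (Γ : Type) : Type := (m : ℕ) → (Fin m → Γ) → (Fin m → ℚ) → ℚ

variable {Γ : Type} [CommGroup Γ]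

/-- `M ∈ ARI(Γ)`: the depth `0` component vanishes. -/
def IsARI (M : Mould Γ) : Prop := ∀ σ x, M 0 σ x = 0

/-- Extension of a tuple of rationals by `0` outside the range. -/
def extQ {m : ℕ} (x : Fin m → ℚ) : ℕ → ℚ := fun i => if h : i < m then x ⟨i, h⟩ else 0

/-- Extension of a tuple of group elements by `1` outside the range. -/
def extG {m : ℕ} (σ : Fin m → Γ) : ℕ → Γ := fun i => if h : i < m then σ ⟨i, h⟩ else 1

/-- The (noncommutative, nonunital on `ARI`) mould product `A × B`. -/
def mouldMul (A B : Mould Γ) : Mould Γ := fun m σ x =>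
  ∑ k ∈ Finset.range (m + 1),
    A k (fun j => extG σ j.val) (fun j => extQ x j.val) *
      B (m - k) (fun j => extG σ (k + j.val)) (fun j => extQ x (k + j.val))

/-- Ecalle's derivation `arit_u(B)(A)` (0-indexed form of the paper's
Definition of `arit_u`; the blocks `k ≤ l` below are 0-based). -/
def aritU (B A : Mould Γ) : Mould Γ := fun m σ x =>
  (∑ k ∈ Finset.range m, ∑ l ∈ Finset.range m,
    if k ≤ l ∧ l + 1 < m then
      A (m - (l - k + 1))
        (fun j => if j.val < k then extG σ j.val
          else if j.val = k then extG σ (l + 1)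
          else extG σ (j.val + (l - k + 1)))
        (fun j => if j.val < k then extQ x j.val
          else if j.val = k then ∑ i ∈ Finset.Icc k (l + 1), extQ x i
          else extQ x (j.val + (l - k + 1))) *
      B (l - k + 1)
        (fun j => extG σ (k + j.val) * (extG σ (l + 1))⁻¹)
        (fun j => extQ x (k + j.val))
    else 0)
  -
  (∑ k ∈ Finset.range m, ∑ l ∈ Finset.range m,
    if 1 ≤ k ∧ k ≤ l then
      A (m - (l - k + 1))
        (fun j => if j.val < k - 1 then extG σ j.val
          else if j.val = k - 1 then extG σ (k - 1)
          else extG σ (j.val + (l - k + 1)))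
        (fun j => if j.val < k - 1 then extQ x j.val
          else if j.val = k - 1 then ∑ i ∈ Finset.Icc (k - 1) l, extQ x i
          else extQ x (j.val + (l - k + 1))) *
      B (l - k + 1)
        (fun j => extG σ (k + j.val) * (extG σ (k - 1))⁻¹)
        (fun j => extQ x (k + j.val))
    else 0)

/-- The `ari_u`-bracket: `ari_u(A,B) = arit_u(B)(A) − arit_u(A)(B) + A×B − B×A`. -/
def ariU (A B : Mould Γ) : Mould Γ :=
  aritU B A - aritU A B + mouldMul A B - mouldMul B A

/-- `preari_u(A,B) = arit_u(B)(A) + A×B`. -/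
def preariU (A B : Mould Γ) : Mould Γ := aritU B A + mouldMul A B

/-- The set of shuffle permutations `Sh(p,q)`. -/
def shuffles (p q : ℕ) : Finset (Equiv.Perm (Fin (p + q))) :=
  Finset.univ.filter fun τ =>
    (∀ i j : Fin (p + q), i.val < j.val → j.val < p → τ⁻¹ i < τ⁻¹ j) ∧
    (∀ i j : Fin (p + q), i.val < j.val → p ≤ i.val → τ⁻¹ i < τ⁻¹ j)

/-- Alternality of a mould. -/
def IsAlternal (M : Mould Γ) : Prop :=
  ∀ p q : ℕ, 1 ≤ p → 1 ≤ q → ∀ (σ : Fin (p + q) → Γ) (x : Fin (p + q) → ℚ),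
    ∑ τ ∈ shuffles p q, M (p + q) (fun i => σ (τ i)) (fun i => x (τ i)) = 0

/-- The `swap` of a mould. -/
def swapM (M : Mould Γ) : Mould Γ := fun m σ v =>
  M m (fun i => ∏ j ∈ Finset.range (m - i.val), extG σ j)
    (fun i => extQ v (m - 1 - i.val) - extQ v (m - i.val))

/-- Bialternality: `M` and `swap(M)` are alternal and the depth `1`
component is even (`M¹(x₁;σ₁) = M¹(−x₁;σ₁⁻¹)`). -/
def IsBialternal (M : Mould Γ) : Prop :=
  IsAlternal M ∧ IsAlternal (swapM M) ∧
    ∀ (σ : Γ) (t : ℚ), M 1 (fun _ => σ) (fun _ => t) = M 1 (fun _ => σ⁻¹) (fun _ => -t)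

/-- The `push` operator. -/
def pushM (M : Mould Γ) : Mould Γ := fun m σ x =>
  M m
    (fun i => if i.val = 0 then (extG σ (m - 1))⁻¹
      else extG σ (i.val - 1) * (extG σ (m - 1))⁻¹)
    (fun i => if i.val = 0 then -(∑ j ∈ Finset.range m, extQ x j)
      else extQ x (i.val - 1))

/-- The `v`-variant `arit_v(B)(A)`. -/
def aritV (B A : Mould Γ) : Mould Γ := fun m σ v =>
  (∑ k ∈ Finset.range m, ∑ l ∈ Finset.range m,
    if k ≤ l ∧ l + 1 < m then
      A (m - (l - k + 1))
        (fun j => if j.val < k then extG σ j.val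
          else if j.val = k then ∏ i ∈ Finset.Icc k (l + 1), extG σ i
          else extG σ (j.val + (l - k + 1)))
        (fun j => if j.val < k then extQ v j.val
          else if j.val = k then extQ v (l + 1)
          else extQ v (j.val + (l - k + 1))) *
      B (l - k + 1)
        (fun j => extG σ (k + j.val))
        (fun j => extQ v (k + j.val) - extQ v (l + 1))
    else 0)
  -
  (∑ k ∈ Finset.range m, ∑ l ∈ Finset.range m,
    if 1 ≤ k ∧ k ≤ l then
      A (m - (l - k + 1))
        (fun j => if j.val < k - 1 then extG σ j.val
          else if j.val = k - 1 then ∏ i ∈ Finset.Icc (k - 1) l, extG σ i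
          else extG σ (j.val + (l - k + 1)))
        (fun j => if j.val < k - 1 then extQ v j.val
          else if j.val = k - 1 then extQ v (k - 1)
          else extQ v (j.val + (l - k + 1))) *
      B (l - k + 1)
        (fun j => extG σ (k + j.val))
        (fun j => extQ v (k + j.val) - extQ v (k - 1))
    else 0)

/-- The `ari_v`-bracket. -/
def ariV (A B : Mould Γ) : Mould Γ :=
  aritV B A - aritV A B + mouldMul A B - mouldMul B A

/-- Pus-neutrality: all cyclic shifts of every component sum to zero. -/
def IsPusNeutral (N : Mould Γ) : Prop :=
  ∀ m : ℕ, 1 ≤ m → ∀ (σ : Fin m → Γ) (v : Fin m → ℚ),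
    ∑ i ∈ Finset.range m,
      N m (fun j => extG σ ((i + j.val) % m)) (fun j => extQ v ((i + j.val) % m)) = 0

/-- The subgroup `Γ^N = {g^N : g ∈ Γ}`. -/
def powSubgroup (Γ : Type) [CommGroup Γ] (N : ℕ) : Subgroup Γ :=
  MonoidHom.range (powMonoidHom N)

/-- The map `i_N : ARI(Γ) → ARI(Γ^N)` (restriction of indices). -/
def iN (N : ℕ) (M : Mould Γ) : Mould (powSubgroup Γ N) := fun m σ x =>
  M m (fun i => (σ i : Γ)) x

/-- The map `m_N : ARI(Γ) → ARI(Γ^N)`. -/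
def mN [Fintype Γ] [DecidableEq Γ] (N : ℕ) (M : Mould Γ) :
    Mould (powSubgroup Γ N) := fun m σ x =>
  ∑ τ ∈ Finset.univ.filter (fun τ : Fin m → Γ => ∀ i, τ i ^ N = (σ i : Γ)),
    M m τ (fun i => (N : ℚ) * x i)

/-- `M` satisfies the distribution relations. -/
def IsARID [Fintype Γ] [DecidableEq Γ] (M : Mould Γ) : Prop :=
  ∀ N : ℕ, 1 ≤ N → N ∣ Fintype.card Γ → iN N M = mN N M

/-- The parallel translation map `t`. -/
def tMap (P : Mould Γ) : Mould Γ := fun m σ v =>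
  if m ≤ 1 then P m σ v
  else P (m - 1) (fun j => extG σ (j.val + 1)) (fun j => extQ v (j.val + 1) - extQ v 0)

/-- `ũ := t ∘ swap`. -/
def uTilde (M : Mould Γ) : Mould Γ := tMap (swapM M)

/-- The group components of `swap` for an `ℕ`-indexed sequence. -/
def swapG (m : ℕ) (s : ℕ → Γ) : Fin m → Γ := fun i => ∏ j ∈ Finset.range (m - i.val), s j

/-- The rational components of `swap` for an `ℕ`-indexed sequence. -/
def swapQ (m : ℕ) (v : ℕ → ℚ) : Fin m → ℚ := fun i => v (m - 1 - i.val) - v (m - i.val)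

/-- The tuple of length `n` obtained from `s` by replacing the block starting at `a` of length
`r + 1` by the single entry `c`. -/
def mergeAt {α : Type} (n a r : ℕ) (c : α) (s : ℕ → α) : Fin n → α := fun j =>
  if j.val < a then s j.val else if j.val = a then c else s (j.val + r)

/-- The summand of `aritU` in which the block `k ≤ l` is absorbed by its right neighbour. -/
def rightU (B A : Mould Γ) (m : ℕ) (s : ℕ → Γ) (x : ℕ → ℚ) (k l : ℕ) : ℚ :=
  A (m - (l - k + 1))
    (mergeAt _ k (l - k + 1) (s (l + 1)) s)
    (mergeAt _ k (l - k + 1) (∑ i ∈ Finset.Icc k (l + 1), x i) x) *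
  B (l - k + 1) (fun j => s (k + j.val) * (s (l + 1))⁻¹) (fun j => x (k + j.val))

/-- The summand of `aritU` in which the block `k ≤ l` is absorbed by its left neighbour. -/
def leftU (B A : Mould Γ) (m : ℕ) (s : ℕ → Γ) (x : ℕ → ℚ) (k l : ℕ) : ℚ :=
  A (m - (l - k + 1))
    (mergeAt _ (k - 1) (l - k + 1) (s (k - 1)) s)
    (mergeAt _ (k - 1) (l - k + 1) (∑ i ∈ Finset.Icc (k - 1) l, x i) x) *
  B (l - k + 1) (fun j => s (k + j.val) * (s (k - 1))⁻¹) (fun j => x (k + j.val))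

/-- The summand of `aritV` in which the block `k ≤ l` is absorbed by its right neighbour. -/
def rightV (B A : Mould Γ) (m : ℕ) (s : ℕ → Γ) (v : ℕ → ℚ) (k l : ℕ) : ℚ :=
  A (m - (l - k + 1))
    (mergeAt _ k (l - k + 1) (∏ i ∈ Finset.Icc k (l + 1), s i) s)
    (mergeAt _ k (l - k + 1) (v (l + 1)) v) *
  B (l - k + 1) (fun j => s (k + j.val)) (fun j => v (k + j.val) - v (l + 1))

/-- The summand of `aritV` in which the block `k ≤ l` is absorbed by its left neighbour. -/
def leftV (B A : Mould Γ) (m : ℕ) (s : ℕ → Γ) (v : ℕ → ℚ) (k l : ℕ) : ℚ :=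
  A (m - (l - k + 1))
    (mergeAt _ (k - 1) (l - k + 1) (∏ i ∈ Finset.Icc (k - 1) l, s i) s)
    (mergeAt _ (k - 1) (l - k + 1) (v (k - 1)) v) *
  B (l - k + 1) (fun j => s (k + j.val)) (fun j => v (k + j.val) - v (k - 1))

/-- The summand of the mould product. -/
def mulTerm (A B : Mould Γ) (m : ℕ) (s : ℕ → Γ) (x : ℕ → ℚ) (k : ℕ) : ℚ :=
  A k (fun j => s j.val) (fun j => x j.val) *
    B (m - k) (fun j => s (k + j.val)) (fun j => x (k + j.val))

lemma mould_congr (M : Mould Γ) {n n' : ℕ} (hn : n = n') {f : Fin n → Γ} {f' : Fin n' → Γ}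
    {g : Fin n → ℚ} {g' : Fin n' → ℚ}
    (hf : ∀ i (h : i < n) (h' : i < n'), f ⟨i, h⟩ = f' ⟨i, h'⟩)
    (hg : ∀ i (h : i < n) (h' : i < n'), g ⟨i, h⟩ = g' ⟨i, h'⟩) :
    M n f g = M n' f' g' := by
  subst hn
  have h₁ : f = f' := funext fun i => hf i i.2 i.2
  have h₂ : g = g' := funext fun i => hg i i.2 i.2
  rw [h₁, h₂]

lemma extG_swapG {m : ℕ} (s : ℕ → Γ) {i : ℕ} (h : i < m) :
    extG (swapG m s) i = ∏ j ∈ Finset.range (m - i), s j := by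
  simp [extG, swapG, h]

lemma extQ_swapQ {m : ℕ} (v : ℕ → ℚ) {i : ℕ} (h : i < m) :
    extQ (swapQ m v) i = v (m - 1 - i) - v (m - i) := by
  simp [extQ, swapQ, h]

lemma sum_Icc_extQ_swapQ {m : ℕ} (v : ℕ → ℚ) {a b : ℕ} (hab : a ≤ b) (hb : b < m) :
    ∑ i ∈ Finset.Icc a b, extQ (swapQ m v) i = v (m - 1 - b) - v (m - a) := by
  induction b, hab using Nat.le_induction with
  | base => simp [extQ_swapQ v hb]
  | succ b hab ih =>
    rw [Finset.sum_Icc_succ_top (by omega), ih (by omega), extQ_swapQ v hb,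
      show m - (b + 1) = m - 1 - b by omega]
    ring

lemma prod_extG_mergeAt_of_le (s : ℕ → Γ) {n a r p : ℕ} (c : Γ) (hp : p ≤ a) (hn : p ≤ n) :
    ∏ j ∈ Finset.range p, extG (mergeAt n a r c s) j = ∏ j ∈ Finset.range p, s j :=
  Finset.prod_congr rfl fun j hj => by
    have hj := Finset.mem_range.1 hj
    simp [extG, mergeAt, show j < n by omega, show j < a by omega]

lemma prod_extG_mergeAt_of_lt (s : ℕ → Γ) {n a b r p : ℕ} (hb : b = a + r) (hp : a < p)
    (hn : p ≤ n) :
    ∏ j ∈ Finset.range p, extG (mergeAt n a r (∏ i ∈ Finset.Icc a b, s i) s) j =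
      ∏ j ∈ Finset.range (p + r), s j := by
  subst hb
  induction p, hp using Nat.le_induction with
  | base =>
    rw [Nat.succ_eq_add_one] at hn ⊢
    rw [Finset.prod_range_succ, prod_extG_mergeAt_of_le s _ le_rfl (by omega)]
    simp only [extG, mergeAt, show a < n by omega, lt_irrefl, dite_true, if_true, if_false]
    rw [← Finset.Ico_add_one_right_eq_Icc, Finset.prod_range_mul_prod_Ico _ (by omega)]
    congr 2
    omega
  | succ p hp ih =>
    rw [Finset.prod_range_succ, ih (by omega), show p + 1 + r = p + r + 1 by omega,
      Finset.prod_range_succ]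
    simp [extG, mergeAt, show p < n by omega, show ¬ p < a by omega, show p ≠ a by omega]

lemma extQ_mergeAt (v : ℕ → ℚ) (n a r : ℕ) (c : ℚ) (i : ℕ) :
    extQ (mergeAt n a r c v) i =
      if i < n then if i < a then v i else if i = a then c else v (i + r) else 0 := rfl

lemma prod_range_extG_add (s : ℕ → Γ) {n p : ℕ} (a : ℕ) (hp : p ≤ n) :
    ∏ j ∈ Finset.range p, extG (fun j : Fin n => s (a + j.val)) j =
      ∏ j ∈ Finset.range p, s (a + j) :=
  Finset.prod_congr rfl fun j hj => by
    simp [extG, (Finset.mem_range.1 hj).trans_le hp]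

lemma extG_mul_const (s : ℕ → Γ) {n i : ℕ} (a : ℕ) (c : Γ) (h : i < n) :
    extG (fun j : Fin n => s (a + j.val) * c) i = s (a + i) * c := by
  simp [extG, h]

lemma extQ_add (v : ℕ → ℚ) {n i : ℕ} (a : ℕ) (h : i < n) :
    extQ (fun j : Fin n => v (a + j.val)) i = v (a + i) := by
  simp [extQ, h]

lemma extQ_sub_const (v : ℕ → ℚ) (n a i : ℕ) (c : ℚ) :
    extQ (fun j : Fin n => v (a + j.val) - c) i = if i < n then v (a + i) - c else 0 := rfl

lemma sum_range_extQ_add (v : ℕ → ℚ) {n a b : ℕ} (hab : a ≤ b) (hn : n = b - a + 1) :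
    ∑ j ∈ Finset.range n, extQ (fun j : Fin n => v (a + j.val)) j = ∑ i ∈ Finset.Icc a b, v i := by
  rw [← Finset.Ico_add_one_right_eq_Icc, Finset.sum_Ico_eq_sum_range,
    show b + 1 - a = n by omega]
  exact Finset.sum_congr rfl fun j hj => extQ_add v a (Finset.mem_range.1 hj)

lemma prod_range_mul_inv (s : ℕ → Γ) (a b : ℕ) :
    (∏ j ∈ Finset.range (a + b), s j) * (∏ j ∈ Finset.range a, s j)⁻¹ =
      ∏ j ∈ Finset.range b, s (a + j) := by
  rw [Finset.prod_range_add, mul_inv_eq_iff_eq_mul, mul_comm]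

lemma rightU_swap (A B : Mould Γ) {m : ℕ} (s : ℕ → Γ) (v : ℕ → ℚ) (hv : v m = 0)
    {k l : ℕ} (hkl : k ≤ l) (hl : l + 1 < m) :
    rightU B A m (extG (swapG m s)) (extQ (swapQ m v)) k l =
      rightV (swapM B) (swapM A) m s v (m - 1 - l) (m - 1 - k) := by
  unfold rightU rightV swapM
  congr 1
  · refine mould_congr A (by omega) (fun i h h' => ?_) (fun i h h' => ?_)
    · simp only [mergeAt]
      by_cases hi : i < k
      · rw [if_pos hi, extG_swapG s (by omega),
          prod_extG_mergeAt_of_lt s (by omega) (by omega) (by omega)]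
        congr 2; omega
      · rw [if_neg hi, prod_extG_mergeAt_of_le s _ (by omega) (by omega)]
        split_ifs <;> rw [extG_swapG s (by omega)] <;> congr 2 <;> omega
    · simp only [mergeAt, extQ_mergeAt]
      rw [sum_Icc_extQ_swapQ v (by omega) hl]
      grind [extQ_swapQ]
  · refine mould_congr B (by omega) (fun i h h' => ?_) (fun i h h' => ?_)
    · dsimp only
      rw [prod_range_extG_add s _ (by omega),
        extG_swapG s (by omega), extG_swapG s (by omega), ← prod_range_mul_inv]
      congr 4 <;> omega
    · dsimp only
      rw [extQ_swapQ v (by omega), extQ_sub_const, extQ_sub_const]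
      grind

lemma leftU_swap (A B : Mould Γ) (hB : pushM B = B) {m : ℕ} (s : ℕ → Γ) (v : ℕ → ℚ)
    (hv : v m = 0) {k l : ℕ} (hk : 1 ≤ k) (hkl : k ≤ l) (hl : l < m) :
    leftU B A m (extG (swapG m s)) (extQ (swapQ m v)) k l =
      leftV (swapM B) (swapM A) m s v (m - l) (m - k) := by
  unfold leftU leftV swapM
  congr 1
  · refine mould_congr A (by omega) (fun i h h' => ?_) (fun i h h' => ?_)
    · simp only [mergeAt]
      by_cases hi : i ≤ k - 1
      · rw [prod_extG_mergeAt_of_lt s (by omega) (by omega) (by omega)]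
        split_ifs <;> (try rw [extG_swapG s (by omega)]) <;> congr 2 <;> omega
      · rw [prod_extG_mergeAt_of_le s _ (by omega) (by omega), if_neg (by omega),
          if_neg (by omega), extG_swapG s (by omega)]
        congr 2; omega
    · simp only [mergeAt, extQ_mergeAt]
      rw [sum_Icc_extQ_swapQ v (by omega) hl]
      grind [extQ_swapQ]
  · conv_lhs => rw [← hB]
    unfold pushM
    refine mould_congr B (by omega) (fun i h h' => ?_) (fun i h h' => ?_)
    · dsimp only
      rw [prod_range_extG_add s _ (by omega), ← prod_range_mul_inv,
        extG_mul_const _ _ _ (by omega), extG_swapG s (by omega), extG_swapG s (by omega),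
        show m - (k + (l - k + 1 - 1)) = m - l by omega]
      split_ifs with hi
      · rw [mul_inv_rev, inv_inv]
        congr 3; omega
      · rw [extG_mul_const _ _ _ (by omega), extG_swapG s (by omega), mul_inv_rev, inv_inv,
          mul_assoc, inv_mul_cancel_left]
        congr 3; omega
    · dsimp only
      rw [sum_range_extQ_add _ hkl rfl, sum_Icc_extQ_swapQ v hkl hl, extQ_sub_const,
        extQ_sub_const]
      split_ifs <;> (try rw [extQ_add _ _ (by omega), extQ_swapQ v (by omega)]) <;> grind

lemma rightV_last (A B : Mould Γ) {m : ℕ} (s : ℕ → Γ) (v : ℕ → ℚ) (hv : v m = 0)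
    {k : ℕ} (hk : k < m) :
    rightV B A m s v k (m - 1) = mulTerm A B m s v k := by
  unfold rightV mulTerm
  congr 1
  · refine mould_congr A (by omega) (fun i h h' => ?_) (fun i h h' => ?_) <;>
      exact if_pos h'
  · refine mould_congr B (by omega) (fun i h h' => rfl) (fun i h h' => ?_)
    simp [show m - 1 + 1 = m by omega, hv]

lemma mulTerm_swap (A B : Mould Γ) {m : ℕ} (s : ℕ → Γ) (v : ℕ → ℚ) (hv : v m = 0)
    {k : ℕ} (hk : 1 ≤ k) (hkm : k < m) :
    mulTerm A B m (extG (swapG m s)) (extQ (swapQ m v)) k =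
      rightV (swapM B) (swapM A) m s v 0 (m - 1 - k) := by
  unfold rightV mulTerm swapM
  congr 1
  · refine mould_congr A (by omega) (fun i h h' => ?_) (fun i h h' => ?_)
    · dsimp only
      rw [extG_swapG s (by omega), prod_extG_mergeAt_of_lt s (by omega) (by omega) (by omega)]
      congr 2; omega
    · dsimp only
      rw [extQ_swapQ v (by omega), extQ_mergeAt, extQ_mergeAt]
      grind
  · refine mould_congr B (by omega) (fun i h h' => ?_) (fun i h h' => ?_)
    · dsimp only
      rw [extG_swapG s (by omega), prod_range_extG_add s _ (by omega)]
      simp only [zero_add]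
      congr 2; omega
    · dsimp only
      rw [extQ_swapQ v (by omega), extQ_sub_const, extQ_sub_const]
      grind

lemma swapM_isARI {M : Mould Γ} (hM : IsARI M) : IsARI (swapM M) := fun _ _ => hM _ _

lemma mouldMul_eq_sum {A B : Mould Γ} (hA : IsARI A) (hB : IsARI B) {m : ℕ} (σ : Fin m → Γ)
    (x : Fin m → ℚ) :
    mouldMul A B m σ x =
      ∑ k ∈ (Finset.range m).filter (1 ≤ ·), mulTerm A B m (extG σ) (extQ x) k := by
  change ∑ k ∈ Finset.range (m + 1), mulTerm A B m (extG σ) (extQ x) k = _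
  refine (Finset.sum_subset (fun k hk => ?_) fun k hk hk' => ?_).symm
  · simp only [Finset.mem_filter, Finset.mem_range] at hk ⊢
    omega
  · simp only [Finset.mem_filter, Finset.mem_range] at hk hk'
    unfold mulTerm
    obtain rfl | rfl : k = 0 ∨ k = m := by omega
    · rw [hA, zero_mul]
    · have h : ∀ n, n = 0 → ∀ τ y, B n τ y = 0 := by
        rintro _ rfl
        exact hB
      rw [h (k - k) (by omega), mul_zero]

lemma sum_sum_ite_eq (m : ℕ) (P : ℕ → ℕ → Prop) [∀ k l, Decidable (P k l)] (f : ℕ → ℕ → ℚ) :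
    (∑ k ∈ Finset.range m, ∑ l ∈ Finset.range m, if P k l then f k l else 0) =
      ∑ p ∈ (Finset.range m ×ˢ Finset.range m).filter (fun p => P p.1 p.2), f p.1 p.2 := by
  rw [Finset.sum_filter, Finset.sum_product]

/-- The compatibility of `swap` with `preari`, which only needs the push-invariance of `B`. -/
lemma swap_preariU_eq {A B : Mould Γ} (hA : IsARI A) (hB : IsARI B) (hpush : pushM B = B) :
    swapM (preariU A B) = aritV (swapM B) (swapM A) + mouldMul (swapM A) (swapM B) := by
  funext m σ v
  set s := extG σ
  set w := extQ v with hw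
  have hv : w m = 0 := by simp [hw, extQ]
  have hright :
      (∑ k ∈ Finset.range m, ∑ l ∈ Finset.range m, if k ≤ l ∧ l + 1 < m then
        rightU B A m (extG (swapG m s)) (extQ (swapQ m w)) k l else 0) +
        mouldMul A B m (swapG m s) (swapQ m w) =
      (∑ k ∈ Finset.range m, ∑ l ∈ Finset.range m, if k ≤ l ∧ l + 1 < m then
        rightV (swapM B) (swapM A) m s w k l else 0) +
        mouldMul (swapM A) (swapM B) m σ v := by
    set F := rightV (swapM B) (swapM A) m s w
    have h₁ : (∑ k ∈ Finset.range m, ∑ l ∈ Finset.range m, if k ≤ l ∧ l + 1 < m then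
        rightU B A m (extG (swapG m s)) (extQ (swapQ m w)) k l else 0) =
        ∑ k ∈ Finset.range m, ∑ l ∈ Finset.range m, if 1 ≤ k ∧ k ≤ l then F k l else 0 := by
      rw [sum_sum_ite_eq, sum_sum_ite_eq]
      refine Finset.sum_nbij' (fun p => (m - 1 - p.2, m - 1 - p.1))
        (fun p => (m - 1 - p.2, m - 1 - p.1)) ?_ ?_ ?_ ?_ ?_ <;>
        simp only [Finset.mem_filter, Finset.mem_product, Finset.mem_range, Prod.forall,
          Prod.mk.injEq]
      · grind
      · grind
      · grind
      · grind
      · intro k l h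
        exact rightU_swap A B s w hv h.2.1 h.2.2
    have h₂ : mouldMul A B m (swapG m s) (swapQ m w) =
        ∑ k ∈ Finset.range m, ∑ l ∈ Finset.range m, if k = 0 ∧ l + 1 < m then F k l else 0 := by
      rw [mouldMul_eq_sum hA hB, sum_sum_ite_eq]
      refine Finset.sum_nbij' (fun k => (0, m - 1 - k)) (fun p => m - 1 - p.2)
        ?_ ?_ ?_ ?_ ?_ <;>
        simp only [Finset.mem_filter, Finset.mem_product, Finset.mem_range, Prod.forall,
          Prod.mk.injEq]
      · grind
      · grind
      · grind
      · grind
      · intro k h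
        exact mulTerm_swap A B s w hv h.2 h.1
    have h₃ : mouldMul (swapM A) (swapM B) m σ v =
        ∑ k ∈ Finset.range m, ∑ l ∈ Finset.range m,
          if 1 ≤ k ∧ l + 1 = m then F k l else 0 := by
      rw [mouldMul_eq_sum (swapM_isARI hA) (swapM_isARI hB), sum_sum_ite_eq]
      refine Finset.sum_nbij' (fun k => (k, m - 1)) (fun p => p.1)
        ?_ ?_ ?_ ?_ ?_ <;>
        simp only [Finset.mem_filter, Finset.mem_product, Finset.mem_range, Prod.forall,
          Prod.mk.injEq]
      · grind
      · grind
      · grind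
      · grind
      · intro k h
        exact (rightV_last _ _ s w hv h.1).symm
    rw [h₁, h₂, h₃]
    simp only [← Finset.sum_add_distrib]
    refine Finset.sum_congr rfl fun k hk => Finset.sum_congr rfl fun l hl => ?_
    rw [Finset.mem_range] at hk hl
    split_ifs <;> first | omega | simp
  have hleft :
      (∑ k ∈ Finset.range m, ∑ l ∈ Finset.range m, if 1 ≤ k ∧ k ≤ l then
        leftU B A m (extG (swapG m s)) (extQ (swapQ m w)) k l else 0) =
      ∑ k ∈ Finset.range m, ∑ l ∈ Finset.range m, if 1 ≤ k ∧ k ≤ l then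
        leftV (swapM B) (swapM A) m s w k l else 0 := by
    rw [sum_sum_ite_eq, sum_sum_ite_eq]
    refine Finset.sum_nbij' (fun p => (m - p.2, m - p.1))
      (fun p => (m - p.2, m - p.1)) ?_ ?_ ?_ ?_ ?_ <;>
      simp only [Finset.mem_filter, Finset.mem_product, Finset.mem_range, Prod.forall,
        Prod.mk.injEq]
    · grind
    · grind
    · grind
    · grind
    · intro k l h
      exact leftU_swap A B hpush s w hv h.2.1 h.2.2 h.1.2
  change (_ - _) + mouldMul A B m (swapG m s) (swapQ m w) =
    (_ - _) + mouldMul (swapM A) (swapM B) m σ v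
  rw [sub_add_eq_add_sub, sub_add_eq_add_sub]
  exact congrArg₂ (· - ·) hright hleft

/-- Lemma: for push-invariant `A, B ∈ ARI(Γ)`,
`swap(ari_u(A,B)) = ari_v(swap(A), swap(B))`. -/
theorem swap_ariU_eq_ariV_swap (Γ : Type) [CommGroup Γ] [Fintype Γ]
    (A B : Mould Γ) (hA : IsARI A) (hB : IsARI B)
    (hApush : pushM A = A) (hBpush : pushM B = B) :
    swapM (ariU A B) = ariV (swapM A) (swapM B) := by
  have hAB := swap_preariU_eq hA hB hBpush
  have hBA := swap_preariU_eq hB hA hApush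
  calc swapM (ariU A B) = swapM (preariU A B) - swapM (preariU B A) := by
        funext m σ v
        simp only [swapM, ariU, preariU, Pi.add_apply, Pi.sub_apply]
        ring
    _ = ariV (swapM A) (swapM B) := by
        rw [hAB, hBA, ariV]
        abel

end KVMould
end

section
/- Proposition: For every N ≥ 1, the map m_N : ARI(Γ) → ARI(Γ^N) is a Lie algebra homomorphism for the ari_u-brackets: m_N(ari_u(A,B)) = ari_u(m_N(A), m_N(B)) for all A, B ∈ ARI(Γ). -/
namespace KVMould

variable {Γ : Type} [CommGroup Γ]

section Extension

lemma extG_of_lt {m : ℕ} (σ : Fin m → Γ) {i : ℕ} (h : i < m) : extG σ i = σ ⟨i, h⟩ := by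
  simp [extG, h]

lemma extG_val {m : ℕ} (σ : Fin m → Γ) (i : Fin m) : extG σ i.val = σ i :=
  extG_of_lt σ i.isLt

lemma extQ_const_mul {m : ℕ} (c : ℚ) (x : Fin m → ℚ) (i : ℕ) :
    extQ (fun j => c * x j) i = c * extQ x i := by
  unfold extQ
  split_ifs <;> simp

lemma extG_pow_eq {N m : ℕ} {σ : Fin m → powSubgroup Γ N} {τ : Fin m → Γ}
    (h : ∀ i, τ i ^ N = (σ i : Γ)) (i : ℕ) : extG τ i ^ N = ((extG σ i : powSubgroup Γ N) : Γ) := by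
  unfold extG
  split_ifs
  · exact h _
  · simp

variable [Fintype Γ] [DecidableEq Γ]

/-- The `N`-th root tuples of `σ` split along the concatenation of tuples. -/
lemma sum_roots_append (N : ℕ) {m k : ℕ} (hk : k ≤ m) (σ : Fin m → powSubgroup Γ N)
    (f : (Fin k → Γ) → ℚ) (g : (Fin (m - k) → Γ) → ℚ) :
    ∑ τ ∈ Finset.univ.filter (fun τ : Fin m → Γ => ∀ i, τ i ^ N = (σ i : Γ)),
        f (fun j => extG τ j.val) * g (fun j => extG τ (k + j.val)) =
      (∑ α ∈ Finset.univ.filter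
          (fun α : Fin k → Γ => ∀ i, α i ^ N = ((extG σ i.val : powSubgroup Γ N) : Γ)), f α) *
        ∑ β ∈ Finset.univ.filter
          (fun β : Fin (m - k) → Γ => ∀ i,
            β i ^ N = ((extG σ (k + i.val) : powSubgroup Γ N) : Γ)), g β := by
  rw [Finset.sum_mul_sum, ← Finset.sum_product']
  refine Finset.sum_nbij'
    (fun τ => (fun j => extG τ j.val, fun j => extG τ (k + j.val)))
    (fun q i => if i.val < k then extG q.1 i.val else extG q.2 (i.val - k)) ?_ ?_ ?_ ?_ ?_
  · intro τ hτ
    simp only [Finset.mem_filter, Finset.mem_univ, true_and] at hτ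
    simp [extG_pow_eq hτ]
  · rintro ⟨α, β⟩ h
    simp only [Finset.mem_product, Finset.mem_filter, Finset.mem_univ, true_and] at h ⊢
    intro i
    split_ifs with hi
    · rw [extG_of_lt α hi, h.1, extG_val]
    · rw [extG_of_lt β (by lia), h.2, ← extG_val σ i]
      congr 2
      lia
  · intro τ _
    funext i
    dsimp only
    split_ifs with hi
    · rw [extG_of_lt _ hi, extG_val]
    · rw [extG_of_lt _ (by lia), ← extG_val τ i]
      congr 1
      lia
  · rintro ⟨α, β⟩ _
    refine Prod.ext (funext fun j => ?_) (funext fun j => ?_)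
    · dsimp only
      rw [extG_of_lt _ (by lia : j.val < m)]
      simp [extG_val]
    · dsimp only
      rw [extG_of_lt _ (by lia : k + j.val < m)]
      simp [extG_val]
  · intro τ _
    rfl

/-- The `N`-th root tuples of `σ` split along the removal of the block of length `d` starting
at `k`, the block being divided by the remaining entry with index `p` after removal. -/
lemma sum_roots_block (N : ℕ) {m k d p : ℕ} (hk : k + d ≤ m) (hp : p < m - d)
    (σ : Fin m → powSubgroup Γ N) (f : (Fin (m - d) → Γ) → ℚ) (g : (Fin d → Γ) → ℚ) :
    ∑ τ ∈ Finset.univ.filter (fun τ : Fin m → Γ => ∀ i, τ i ^ N = (σ i : Γ)),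
        f (fun j => extG τ (if j.val < k then j.val else j.val + d)) *
          g (fun j => extG τ (k + j.val) * (extG τ (if p < k then p else p + d))⁻¹) =
      (∑ α ∈ Finset.univ.filter (fun α : Fin (m - d) → Γ =>
          ∀ i, α i ^ N =
            ((extG σ (if i.val < k then i.val else i.val + d) : powSubgroup Γ N) : Γ)), f α) *
        ∑ β ∈ Finset.univ.filter (fun β : Fin d → Γ =>
          ∀ i, β i ^ N =
            ((extG σ (k + i.val) * (extG σ (if p < k then p else p + d))⁻¹ :
              powSubgroup Γ N) : Γ)), g β := by
  rw [Finset.sum_mul_sum, ← Finset.sum_product']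
  refine Finset.sum_nbij'
    (fun τ => (fun j => extG τ (if j.val < k then j.val else j.val + d),
      fun j => extG τ (k + j.val) * (extG τ (if p < k then p else p + d))⁻¹))
    (fun q i => if i.val < k then extG q.1 i.val
      else if i.val < k + d then extG q.2 (i.val - k) * extG q.1 p
      else extG q.1 (i.val - d)) ?_ ?_ ?_ ?_ ?_
  · intro τ hτ
    simp only [Finset.mem_filter, Finset.mem_univ, true_and] at hτ
    simp [mul_pow, extG_pow_eq hτ]
  · rintro ⟨α, β⟩ h
    simp only [Finset.mem_product, Finset.mem_filter, Finset.mem_univ, true_and] at h ⊢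
    intro i
    rw [← extG_val σ i]
    split_ifs with hi hi'
    · rw [extG_of_lt α (by lia), h.1, if_pos hi]
    · rw [extG_of_lt α hp, extG_of_lt β (by lia), mul_pow, h.1, h.2, ← Subgroup.coe_mul,
        inv_mul_cancel_right]
      congr 2
      dsimp only
      lia
    · rw [extG_of_lt α (by lia), h.1, if_neg (by dsimp only; lia)]
      congr 2
      dsimp only
      lia
  · intro τ _
    funext i
    dsimp only
    rw [← extG_val τ i]
    split_ifs with hi hi'
    all_goals
      first
      | rw [extG_of_lt _ (by lia : i.val < m - d), if_pos hi]
      | rw [extG_of_lt _ (by lia : i.val - k < d), extG_of_lt _ hp]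
        dsimp only
        simp only [*, if_true, if_false, inv_mul_cancel_right]
        congr 1
        lia
      | rw [extG_of_lt _ (by lia : i.val - d < m - d), if_neg (by dsimp only; lia)]
        congr 1
        dsimp only
        lia
  · rintro ⟨α, β⟩ _
    have key : ∀ j : ℕ, j < m - d →
        extG (fun i : Fin m => if i.val < k then extG α i.val
          else if i.val < k + d then extG β (i.val - k) * extG α p
          else extG α (i.val - d)) (if j < k then j else j + d) = extG α j := by
      intro j hj
      rw [extG_of_lt _ (by split_ifs <;> lia)]
      by_cases hjk : j < k
      · simp [hjk]
      · simp [hjk, (by lia : ¬ j + d < k), (by lia : ¬ j + d < k + d)]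
    refine Prod.ext (funext fun j => ?_) (funext fun j => ?_)
    · dsimp only
      rw [key j j.isLt, extG_val]
    · dsimp only
      rw [key p hp, extG_of_lt _ (by lia : k + j.val < m)]
      simp [extG_val]
  · intro τ _
    rfl

lemma mN_add (N : ℕ) (A B : Mould Γ) : mN N (A + B) = mN N A + mN N B := by
  funext m σ x
  simp [mN, Finset.sum_add_distrib]

lemma mN_sub (N : ℕ) (A B : Mould Γ) : mN N (A - B) = mN N A - mN N B := by
  funext m σ x
  simp [mN, Finset.sum_sub_distrib]

lemma mN_mouldMul (N : ℕ) (A B : Mould Γ) :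
    mN N (mouldMul A B) = mouldMul (mN N A) (mN N B) := by
  funext m σ x
  simp only [mN, mouldMul]
  rw [Finset.sum_comm]
  refine Finset.sum_congr rfl fun k hk => ?_
  simp only [extQ_const_mul]
  exact sum_roots_append N (Nat.lt_succ_iff.mp (Finset.mem_range.mp hk)) σ
    (fun α => A k α _) (fun β => B (m - k) β _)

lemma mN_aritU (N : ℕ) (A B : Mould Γ) :
    mN N (aritU B A) = aritU (mN N B) (mN N A) := by
  funext m σ x
  simp only [mN, aritU]
  rw [Finset.sum_sub_distrib]
  congr 1
  · rw [Finset.sum_comm]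
    refine Finset.sum_congr rfl fun k _ => ?_
    rw [Finset.sum_comm]
    refine Finset.sum_congr rfl fun l _ => ?_
    split_ifs with h
    · have hG : ∀ {H : Type} [CommGroup H] (τ : Fin m → H) (j : ℕ),
          (if j < k then extG τ j else if j = k then extG τ (l + 1)
            else extG τ (j + (l - k + 1))) =
          extG τ (if j < k then j else j + (l - k + 1)) := by
        intro H _ τ j
        split_ifs <;> first | rfl | (congr 1; lia)
      have hc : l + 1 = if k < k then k else k + (l - k + 1) := by
        rw [if_neg (lt_irrefl k)]; lia
      have := sum_roots_block N (k := k) (d := l - k + 1) (p := k) (m := m)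
        (by lia) (by lia) σ
        (fun α => A (m - (l - k + 1)) α (fun j => N * (if j.val < k then extQ x j.val
          else if j.val = k then ∑ i ∈ Finset.Icc k (l + 1), extQ x i
          else extQ x (j.val + (l - k + 1)))))
        (fun β => B (l - k + 1) β (fun j => N * extQ x (k + j.val)))
      rw [← hc] at this
      simp only [hG, extQ_const_mul, ← Finset.mul_sum, ← mul_ite]
      exact this
    · exact Finset.sum_const_zero
  · rw [Finset.sum_comm]
    refine Finset.sum_congr rfl fun k _ => ?_
    rw [Finset.sum_comm]
    refine Finset.sum_congr rfl fun l hl => ?_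
    have hl := Finset.mem_range.mp hl
    split_ifs with h
    · have hG : ∀ {H : Type} [CommGroup H] (τ : Fin m → H) (j : ℕ),
          (if j < k - 1 then extG τ j else if j = k - 1 then extG τ (k - 1)
            else extG τ (j + (l - k + 1))) =
          extG τ (if j < k then j else j + (l - k + 1)) := by
        intro H _ τ j
        split_ifs <;> first | rfl | (congr 1; lia)
      have hc : k - 1 = if k - 1 < k then k - 1 else k - 1 + (l - k + 1) := by
        rw [if_pos (by lia)]
      have := sum_roots_block N (k := k) (d := l - k + 1) (p := k - 1) (m := m)
        (by lia) (by lia) σ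
        (fun α => A (m - (l - k + 1)) α (fun j => N * (if j.val < k - 1 then extQ x j.val
          else if j.val = k - 1 then ∑ i ∈ Finset.Icc (k - 1) l, extQ x i
          else extQ x (j.val + (l - k + 1)))))
        (fun β => B (l - k + 1) β (fun j => N * extQ x (k + j.val)))
      rw [← hc] at this
      simp only [hG, extQ_const_mul, ← Finset.mul_sum, ← mul_ite]
      exact this
    · exact Finset.sum_const_zero

end Extension

/-- Proposition: for every `N ≥ 1`, `m_N : ARI(Γ) → ARI(Γ^N)` is a Lie
algebra homomorphism for the `ari_u`-brackets. -/
theorem mN_lieHom (Γ : Type) [CommGroup Γ] [Fintype Γ] [DecidableEq Γ]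
    (N : ℕ) (hN : 1 ≤ N) (A B : Mould Γ) (hA : IsARI A) (hB : IsARI B) :
    mN N (ariU A B) = ariU (mN N A) (mN N B) := by
  simp only [ariU, mN_add, mN_sub, mN_mouldMul, mN_aritU]

end KVMould
end

section
/- Proposition: Every bialternal mould M ∈ ARI(Γ) is push-invariant: push(M) = M. -/
namespace KVMould

variable {Γ : Type} [CommGroup Γ]

/-- The permutation of `Fin n` reversing the first `p` entries and fixing the others. -/
def reversePrefix (n p : ℕ) (hp : p ≤ n) : Equiv.Perm (Fin n) :=
  Function.Involutive.toPerm
    (fun i => if h : i.val < p then ⟨p - 1 - i.val, by omega⟩ else i) (by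
      intro i
      ext
      by_cases h : i.val < p
      · have h' : p - 1 - i.val < p := by omega
        simp only [h, h', dite_true]
        omega
      · simp [h])

lemma reversePrefix_val {n p : ℕ} (hp : p ≤ n) (i : Fin n) :
    (reversePrefix n p hp i).val = if i.val < p then p - 1 - i.val else i.val := by
  change (if h : i.val < p then (⟨p - 1 - i.val, by omega⟩ : Fin n) else i).val = _
  split_ifs <;> rfl

lemma reversePrefix_inv {n p : ℕ} (hp : p ≤ n) :
    (reversePrefix n p hp)⁻¹ = reversePrefix n p hp := rfl

/-- The permutations `τ` such that `τ⁻¹` decreases up to `k` and increases from `k` on. -/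
def valleys (n k : ℕ) : Finset (Equiv.Perm (Fin n)) :=
  Finset.univ.filter fun τ =>
    (∀ i j : Fin n, i.val < j.val → j.val ≤ k → τ⁻¹ j < τ⁻¹ i) ∧
    (∀ i j : Fin n, i.val < j.val → k ≤ i.val → τ⁻¹ i < τ⁻¹ j)

/-- The permutations `τ` such that `τ⁻¹` decreases before `p` and increases from `p` on. -/
def reversedShuffles (n p : ℕ) : Finset (Equiv.Perm (Fin n)) :=
  Finset.univ.filter fun τ =>
    (∀ i j : Fin n, i.val < j.val → j.val < p → τ⁻¹ j < τ⁻¹ i) ∧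
    (∀ i j : Fin n, i.val < j.val → p ≤ i.val → τ⁻¹ i < τ⁻¹ j)

lemma sum_shuffles_eq_sum_reversedShuffles (p q : ℕ) (f : Equiv.Perm (Fin (p + q)) → ℚ) :
    ∑ τ ∈ shuffles p q, f (reversePrefix (p + q) p (by omega) * τ) =
      ∑ τ ∈ reversedShuffles (p + q) p, f τ := by
  have hval := reversePrefix_val (n := p + q) (p := p) (by omega)
  have hinv := reversePrefix_inv (n := p + q) (p := p) (by omega)
  generalize reversePrefix (p + q) p (by omega) = r at hval hinv ⊢
  have hrr : ∀ i, r (r i) = i := fun i => by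
    nth_rewrite 1 [← hinv]
    simp
  refine Finset.sum_equiv (Equiv.mulLeft r) (fun τ => ?_) (fun _ _ => rfl)
  simp only [shuffles, reversedShuffles, Finset.mem_filter, Finset.mem_univ, true_and,
    Equiv.coe_mulLeft, mul_inv_rev, hinv, Equiv.Perm.mul_apply]
  constructor
  · rintro ⟨h1, h2⟩
    refine ⟨fun i j hij hj => h1 _ _ ?_ ?_, fun i j hij hi => h2 _ _ ?_ ?_⟩ <;>
      simp only [hval] <;> split_ifs <;> omega
  · rintro ⟨h1, h2⟩
    refine ⟨fun i j hij hj => ?_, fun i j hij hi => ?_⟩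
    · have := h1 (r j) (r i) (by simp only [hval]; split_ifs <;> omega)
        (by simp only [hval]; split_ifs <;> omega)
      simpa only [hrr] using this
    · have := h2 (r i) (r j) (by simp only [hval]; split_ifs <;> omega)
        (by simp only [hval]; split_ifs <;> omega)
      simpa only [hrr] using this

lemma sum_reversedShuffles {n k : ℕ} (hk : k + 1 < n) (f : Equiv.Perm (Fin n) → ℚ) :
    ∑ τ ∈ reversedShuffles n (k + 1), f τ =
      ∑ τ ∈ valleys n k, f τ + ∑ τ ∈ valleys n (k + 1), f τ := by
  have hdisj : Disjoint (valleys n k) (valleys n (k + 1)) := by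
    rw [Finset.disjoint_left]
    intro τ h1 h2
    simp only [valleys, Finset.mem_filter, Finset.mem_univ, true_and] at h1 h2
    exact lt_asymm (h1.2 ⟨k, by omega⟩ ⟨k + 1, hk⟩ (by simp) (by simp))
      (h2.1 ⟨k, by omega⟩ ⟨k + 1, hk⟩ (by simp) (by simp))
  rw [← Finset.sum_union hdisj]
  congr 1
  ext τ
  simp only [valleys, reversedShuffles, Finset.mem_union, Finset.mem_filter, Finset.mem_univ,
    true_and]
  constructor
  · rintro ⟨h1, h2⟩
    have hne : τ⁻¹ ⟨k, by omega⟩ ≠ τ⁻¹ ⟨k + 1, hk⟩ := by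
      intro h
      simpa using τ⁻¹.injective h
    rcases lt_or_gt_of_ne hne with h | h
    · refine Or.inl ⟨fun i j hij hj => h1 i j hij (by omega), fun i j hij hi => ?_⟩
      rcases Nat.lt_or_ge k i.val with hi' | hi'
      · exact h2 i j hij hi'
      · have hik : i = ⟨k, by omega⟩ := Fin.ext (by simp; omega)
        rw [hik]
        rcases Nat.lt_or_ge (k + 1) j.val with hj | hj
        · exact h.trans (h2 _ _ (by simpa using hj) (by simp))
        · have hjk : j = ⟨k + 1, hk⟩ := Fin.ext (by simp at hij ⊢; omega)
          rw [hjk]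
          exact h
    · refine Or.inr ⟨fun i j hij hj => ?_, h2⟩
      rcases Nat.lt_or_ge j.val (k + 1) with hj' | hj'
      · exact h1 i j hij hj'
      · obtain rfl : j = ⟨k + 1, hk⟩ := Fin.ext (by simp; omega)
        rcases Nat.lt_or_ge i.val k with hi | hi
        · exact h.trans (h1 _ _ (by simpa using hi) (by simp))
        · have hik : i = ⟨k, by omega⟩ := Fin.ext (by simp at hij ⊢; omega)
          rw [hik]
          exact h
  · rintro (⟨h1, h2⟩ | ⟨h1, h2⟩)
    · exact ⟨fun i j hij hj => h1 i j hij (by omega), fun i j hij hi => h2 i j hij (by omega)⟩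
    · exact ⟨fun i j hij hj => h1 i j hij (by omega), fun i j hij hi => h2 i j hij (by omega)⟩

lemma valleys_zero (n : ℕ) : valleys n 0 = {1} := by
  ext τ
  simp only [valleys, Finset.mem_filter, Finset.mem_univ, true_and, Finset.mem_singleton]
  constructor
  · rintro ⟨-, h⟩
    have hmono : StrictMono (τ⁻¹ : Equiv.Perm (Fin n)) := fun i j hij => h i j hij (Nat.zero_le _)
    have hid : ∀ i, τ⁻¹ i = i := fun i =>
      congrFun (hmono.range_inj (g := id) strictMono_id |>.1 (by simp)) i
    exact inv_eq_one.1 (Equiv.ext hid)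
  · rintro rfl
    exact ⟨fun i j hij hj => by omega, fun i j hij _ => by simpa using hij⟩

lemma valleys_last (n : ℕ) : valleys (n + 1) n = {Fin.revPerm} := by
  ext τ
  simp only [valleys, Finset.mem_filter, Finset.mem_univ, true_and, Finset.mem_singleton]
  constructor
  · rintro ⟨h, -⟩
    have hmono : StrictMono (fun i => τ⁻¹ (Fin.rev i)) := fun i j hij =>
      h _ _ (Fin.rev_lt_rev.2 hij) (by omega)
    have hr : Set.range (fun i => τ⁻¹ (Fin.rev i)) = Set.univ :=
      ((τ⁻¹).surjective.comp Fin.rev_surjective).range_eq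
    have hid : ∀ i, τ⁻¹ (Fin.rev i) = i := fun i =>
      congrFun (hmono.range_inj (g := id) strictMono_id |>.1 (hr.trans Set.range_id.symm)) i
    refine Equiv.ext fun i => ?_
    have := congrArg τ (hid i)
    simpa using this.symm
  · rintro rfl
    refine ⟨fun i j hij _ => ?_, fun i j hij hi => by omega⟩
    change Fin.rev j < Fin.rev i
    exact Fin.rev_lt_rev.2 hij

omit [CommGroup Γ] in
/-- The sums of an alternal mould over successive valley classes differ by a sign. -/
lemma IsAlternal.sum_valleys {M : Mould Γ} (hM : IsAlternal M) {n k : ℕ}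
    (hk : k < n) (σ : Fin n → Γ) (x : Fin n → ℚ) :
    ∑ τ ∈ valleys n k, M n (fun i => σ (τ i)) (fun i => x (τ i)) = (-1) ^ k * M n σ x := by
  induction k with
  | zero => simp [valleys_zero]
  | succ k ih =>
    have key : ∑ τ ∈ reversedShuffles n (k + 1), M n (fun i => σ (τ i)) (fun i => x (τ i)) = 0 := by
      obtain ⟨q, rfl⟩ : ∃ q, n = k + 1 + q := ⟨n - (k + 1), by omega⟩
      rw [← sum_shuffles_eq_sum_reversedShuffles]
      exact hM (k + 1) q (by omega) (by omega)
        (fun i => σ (reversePrefix _ (k + 1) (by omega) i))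
        (fun i => x (reversePrefix _ (k + 1) (by omega) i))
    rw [sum_reversedShuffles hk, ih (by omega)] at key
    rw [pow_succ]
    linarith

omit [CommGroup Γ] in
/-- An alternal mould is invariant under reversal of its arguments, up to the sign `(-1)^n`
in depth `n + 1`. -/
lemma IsAlternal.reverse {M : Mould Γ} (hM : IsAlternal M) (n : ℕ)
    (σ : Fin (n + 1) → Γ) (x : Fin (n + 1) → ℚ) :
    M (n + 1) (fun i => σ i.rev) (fun i => x i.rev) = (-1) ^ n * M (n + 1) σ x := by
  have := hM.sum_valleys (Nat.lt_succ_self n) σ x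
  simpa [valleys_last] using this

/-- The index map on sequences that moves the letter in position `1` to position `k + 1`. -/
def insertIndex (k i : ℕ) : ℕ :=
  if i = 0 then 0 else if i ≤ k then i + 1 else if i = k + 1 then 1 else i

lemma sum_insertIndex {n k : ℕ} (hk : k < n) (z : ℕ → ℚ) :
    ∑ i ∈ Finset.range (n + 1), z (insertIndex k i) = ∑ i ∈ Finset.range (n + 1), z i := by
  refine Finset.sum_nbij' (insertIndex k)
    (fun i => if i = 0 then 0 else if i = 1 then k + 1 else if i ≤ k + 1 then i - 1 else i)
    ?_ ?_ ?_ ?_ (fun _ _ => rfl) <;>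
  · intro i hi
    simp only [Finset.mem_range, insertIndex] at hi ⊢
    grind

/-- The index map on sequences of letters `0, …, m` that rotates them to the left. -/
def rotateIndex (m i : ℕ) : ℕ := if i = m then 0 else i + 1

lemma sum_rotateIndex (m : ℕ) (z : ℕ → ℚ) :
    ∑ i ∈ Finset.range (m + 1), z (rotateIndex m i) = ∑ i ∈ Finset.range (m + 1), z i := by
  rw [Finset.sum_range_succ, Finset.sum_range_succ' z]
  congr 1
  · refine Finset.sum_congr rfl fun i hi => ?_
    rw [rotateIndex, if_neg (Finset.mem_range.1 hi).ne]
  · rw [rotateIndex, if_pos rfl]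

lemma eq_cycleRange_of_strictMono {n : ℕ} (τ : Equiv.Perm (Fin (n + 1)))
    (h : ∀ i j : Fin (n + 1), i.val < j.val → 1 ≤ i.val → τ⁻¹ i < τ⁻¹ j) :
    τ = (τ⁻¹ 0).cycleRange := by
  have hmono : StrictMono (fun i : Fin n => τ⁻¹ i.succ) := fun i j hij =>
    h _ _ (Fin.succ_lt_succ_iff.2 hij) (by simp)
  have hrange : Set.range (fun i : Fin n => τ⁻¹ i.succ) = Set.range (τ⁻¹ 0).succAbove := by
    rw [Fin.range_succAbove, ← Set.image_singleton, ← Set.image_compl_eq (τ⁻¹).bijective,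
      ← Fin.range_succ, ← Set.range_comp]
    rfl
  have heq := (hmono.range_inj (Fin.strictMono_succAbove _)).1 hrange
  have hinv : τ⁻¹ = (τ⁻¹ 0).cycleRange.symm := by
    refine Equiv.ext fun i => ?_
    refine Fin.cases ?_ (fun i => ?_) i
    · rw [Fin.cycleRange_symm_zero]
    · rw [Fin.cycleRange_symm_succ]
      exact congrFun heq i
  exact inv_injective hinv

lemma cycleRange_inv_lt {n : ℕ} (k i j : Fin (n + 1)) (hij : i.val < j.val) (hi : 1 ≤ i.val) :
    k.cycleRange⁻¹ i < k.cycleRange⁻¹ j := by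
  obtain ⟨i, rfl⟩ := Fin.exists_succ_eq.2 (show i ≠ 0 by rintro rfl; simp at hi)
  obtain ⟨j, rfl⟩ := Fin.exists_succ_eq.2 (show j ≠ 0 by rintro rfl; simp at hij)
  change k.cycleRange.symm _ < k.cycleRange.symm _
  rw [Fin.cycleRange_symm_succ, Fin.cycleRange_symm_succ]
  exact Fin.strictMono_succAbove k (by simpa using hij)

lemma sum_cycleRange {n : ℕ} (f : Equiv.Perm (Fin (n + 1)) → ℚ) :
    ∑ τ : Equiv.Perm (Fin (n + 1)) with
        ∀ i j : Fin (n + 1), i.val < j.val → 1 ≤ i.val → τ⁻¹ i < τ⁻¹ j, f τ =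
      ∑ k : Fin (n + 1), f k.cycleRange := by
  refine (Finset.sum_nbij' Fin.cycleRange (fun τ => τ⁻¹ 0) ?_ ?_ ?_ ?_ ?_).symm
  · intro k _
    simpa using cycleRange_inv_lt k
  · simp
  · intro k _
    exact Fin.cycleRange_symm_zero k
  · intro τ hτ
    exact (eq_cycleRange_of_strictMono τ (Finset.mem_filter.1 hτ).2).symm
  · simp

lemma cycleRange_val_succ {n : ℕ} (k i : Fin (n + 1)) :
    (k.cycleRange i).val + 1 = insertIndex k.val (i.val + 1) := by
  rcases lt_trichotomy i k with h | h | h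
  · rw [Fin.coe_cycleRange_of_lt h, insertIndex, if_neg (by omega), if_pos (by omega)]
  · rw [Fin.cycleRange_of_eq h, insertIndex, if_neg (by omega), if_neg (by omega),
      if_pos (by omega)]
    rfl
  · rw [Fin.cycleRange_of_gt h, insertIndex, if_neg (by omega), if_neg (by omega),
      if_neg (by omega)]

omit [CommGroup Γ] in
lemma IsAlternal.sum_cycleRange_eq_zero {M : Mould Γ} (hM : IsAlternal M) (n : ℕ)
    (σ : Fin (n + 2) → Γ) (x : Fin (n + 2) → ℚ) :
    ∑ k : Fin (n + 2), M (n + 2) (fun i => σ (k.cycleRange i)) (fun i => x (k.cycleRange i)) = 0 := by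
  rw [← sum_cycleRange fun τ => M (n + 2) (fun i => σ (τ i)) (fun i => x (τ i))]
  have hq : n + 1 + 1 = 1 + (n + 1) := by omega
  change Fin (n + 1 + 1) → Γ at σ
  change Fin (n + 1 + 1) → ℚ at x
  change ∑ τ : Equiv.Perm (Fin (n + 1 + 1)) with
    ∀ i j : Fin (n + 1 + 1), i.val < j.val → 1 ≤ i.val → τ⁻¹ i < τ⁻¹ j,
      M (n + 1 + 1) (fun i => σ (τ i)) (fun i => x (τ i)) = 0
  generalize n + 1 + 1 = q at σ x hq ⊢
  subst hq
  refine Eq.trans (Finset.sum_congr ?_ fun _ _ => rfl) (hM 1 (n + 1) le_rfl (by omega) σ x)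
  ext τ
  simp only [shuffles, Finset.mem_filter, Finset.mem_univ, true_and]
  exact ⟨fun h => ⟨fun i j hij hj => by omega, h⟩, fun h => h.2⟩

/-- The component `M m` in homogeneous coordinates indexed by `0, …, m`. -/
def cyc (M : Mould Γ) (m : ℕ) (g : ℕ → Γ) (z : ℕ → ℚ) : ℚ :=
  M m (fun i => g (i.val + 1) * (g 0)⁻¹) (fun i => z (i.val + 1))

lemma cyc_congr (M : Mould Γ) {m : ℕ} {g g' : ℕ → Γ} {z z' : ℕ → ℚ}
    (hg : ∀ i ≤ m, g i = g' i) (hz : ∀ i ≤ m, z i = z' i) : cyc M m g z = cyc M m g' z' := by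
  unfold cyc
  congr 1
  · funext i
    rw [hg _ (by omega), hg _ (by omega)]
  · funext i
    rw [hz _ (by omega)]

lemma cyc_reverse {M : Mould Γ} (hM : IsAlternal M) (n : ℕ) (g : ℕ → Γ) (z : ℕ → ℚ) :
    cyc M (n + 1) (fun i => if i = 0 then g 0 else g (n + 2 - i))
      (fun i => if i = 0 then z 0 else z (n + 2 - i)) = (-1) ^ n * cyc M (n + 1) g z := by
  unfold cyc
  rw [← hM.reverse]
  congr 1
  · funext i
    have : n + 2 - (i.val + 1) = i.rev.val + 1 := by simp [Fin.val_rev]; omega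
    simp [this]
  · funext i
    have : n + 2 - (i.val + 1) = i.rev.val + 1 := by simp [Fin.val_rev]; omega
    simp [this]

lemma cyc_swap_reverse {M : Mould Γ} (hM : IsAlternal (swapM M)) (n : ℕ) (g : ℕ → Γ) (z : ℕ → ℚ)
    (hz : ∑ i ∈ Finset.range (n + 2), z i = 0) :
    cyc M (n + 1) (fun i => if i = 0 then (g 1)⁻¹ else if i = 1 then (g 0)⁻¹ else (g (n + 3 - i))⁻¹)
      (fun i => if i = 0 then -z 1 else if i = 1 then -z 0 else -z (n + 3 - i)) =
      (-1) ^ n * cyc M (n + 1) g z := by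
  set g' : ℕ → Γ := fun i => if i ≤ n + 1 then g i else g 0 with hg'
  have key := hM.reverse n (fun j => g' (n + 1 - j.val) * (g' (n + 2 - j.val))⁻¹)
    (fun j => ∑ i ∈ Finset.range (n + 1 - j.val), z (i + 1))
  have hright : ∀ k ≤ n + 1, ∏ j ∈ Finset.range k,
      extG (fun j : Fin (n + 1) => g' (n + 1 - j.val) * (g' (n + 2 - j.val))⁻¹) j =
      g' (n + 2 - k) * (g 0)⁻¹ := by
    intro k hk
    induction k with
    | zero => simp [hg']
    | succ k ih =>
      rw [Finset.prod_range_succ, ih (by omega), extG, dif_pos (by omega)]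
      simp only [show n + 2 - (k + 1) = n + 1 - k by omega]
      rw [mul_comm, mul_assoc, inv_mul_cancel_left]
  have hleft : ∀ k ≤ n + 1, ∏ j ∈ Finset.range k,
      extG (fun j : Fin (n + 1) => g' (n + 1 - j.rev.val) * (g' (n + 2 - j.rev.val))⁻¹) j =
      g 1 * (g' (k + 1))⁻¹ := by
    intro k hk
    induction k with
    | zero => simp [hg']
    | succ k ih =>
      rw [Finset.prod_range_succ, ih (by omega), extG, dif_pos (by omega)]
      simp only [Fin.val_rev, show n + 1 - (n + 1 - (k + 1)) = k + 1 by omega,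
        show n + 2 - (n + 1 - (k + 1)) = k + 2 by omega]
      rw [mul_assoc, inv_mul_cancel_left]
  have hz' : ∑ i ∈ Finset.range (n + 1), z (i + 1) = -z 0 := by
    rw [Finset.sum_range_succ'] at hz
    linarith
  convert key using 2
  · unfold cyc swapM
    congr 1
    · funext i
      rw [hleft _ (by omega)]
      by_cases hi : i.val = 0
      · simp [hi, hg', mul_comm]
      · have h1 : n + 1 - i.val + 1 = n + 3 - (i.val + 1) := by omega
        have h2 : n + 3 - (i.val + 1) ≤ n + 1 := by omega
        simp [hi, hg', mul_comm, h1]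
        omega
    · funext i
      by_cases hi : i.val = 0
      · simp [hi, extQ, Fin.val_rev, hz']
      · have h1 : n + 1 - 1 - i.val < n + 1 := by omega
        have h2 : n + 1 - i.val < n + 1 := by omega
        simp only [extQ, h1, h2, dite_true, Fin.val_rev]
        rw [show n + 1 - (n + 1 - (n + 1 - i.val + 1)) = (n + 1 - i.val) + 1 by omega,
          show n + 1 - (n + 1 - (n + 1 - 1 - i.val + 1)) = n + 1 - i.val by omega,
          Finset.sum_range_succ, show n + 1 - i.val + 1 = n + 3 - (i.val + 1) by omega]
        simp [hi]
  · unfold cyc swapM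
    congr 1
    · funext i
      rw [hright _ (by omega), show n + 2 - (n + 1 - i.val) = i.val + 1 by omega]
      simp only [hg']
      rw [if_pos (by omega)]
    · funext i
      by_cases hi : i.val = 0
      · simp [hi, extQ]
      · have h1 : n + 1 - 1 - i.val < n + 1 := by omega
        have h2 : n + 1 - i.val < n + 1 := by omega
        simp only [extQ, h1, h2, dite_true]
        rw [show n + 1 - (n + 1 - 1 - i.val) = i.val + 1 by omega,
          show n + 1 - (n + 1 - i.val) = i.val by omega, Finset.sum_range_succ]
        ring

/-- For a mould that is alternal with alternal swap, `push` coincides with `neg`. -/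
lemma cyc_neg_rotate {M : Mould Γ} (hM : IsAlternal M) (hS : IsAlternal (swapM M)) (n : ℕ)
    (g : ℕ → Γ) (z : ℕ → ℚ) (hz : ∑ i ∈ Finset.range (n + 2), z i = 0) :
    cyc M (n + 1) (fun i => (g (rotateIndex (n + 1) i))⁻¹)
      (fun i => -z (rotateIndex (n + 1) i)) = cyc M (n + 1) g z := by
  have h1 := cyc_swap_reverse hS n g z hz
  have h2 := cyc_reverse hM n (fun i => (g (rotateIndex (n + 1) i))⁻¹)
    (fun i => -z (rotateIndex (n + 1) i))
  have hsign : ((-1 : ℚ) ^ n) ≠ 0 := by positivity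
  refine mul_left_cancel₀ hsign (h2.symm.trans (Eq.trans (cyc_congr M ?_ ?_) h1)) <;>
  · intro i hi
    rcases Nat.lt_or_ge i 2 with h | h
    · interval_cases i <;> simp [rotateIndex]
    · rw [if_neg (by omega), if_neg (by omega), if_neg (by omega), rotateIndex,
        if_neg (by omega), show n + 2 - i + 1 = n + 3 - i by omega]

lemma cyc_sum_insert {M : Mould Γ} (hM : IsAlternal M) (n : ℕ) (g : ℕ → Γ) (z : ℕ → ℚ) :
    ∑ k ∈ Finset.range (n + 2), cyc M (n + 2) (fun i => g (insertIndex k i))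
      (fun i => z (insertIndex k i)) = 0 := by
  rw [Finset.sum_range]
  refine Eq.trans (Finset.sum_congr rfl fun k _ => ?_)
    (hM.sum_cycleRange_eq_zero n (fun i => g (i.val + 1) * (g 0)⁻¹) (fun i => z (i.val + 1)))
  unfold cyc
  simp only [cycleRange_val_succ]
  rfl

lemma cyc_rotate {M : Mould Γ} (hM : IsAlternal M) (hS : IsAlternal (swapM M)) (n : ℕ)
    (g : ℕ → Γ) (z : ℕ → ℚ) (hz : ∑ i ∈ Finset.range (n + 3), z i = 0) :
    cyc M (n + 2) (fun i => g (rotateIndex (n + 2) i))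
      (fun i => z (rotateIndex (n + 2) i)) = cyc M (n + 2) g z := by
  set p : ℕ → ℕ := fun i => if i = 0 then 2 else if i = 1 then 1 else if i = n + 2 then 0 else i + 1
    with hp
  have h1 := cyc_sum_insert hM n g z
  have h2 := cyc_sum_insert hM n (fun i => (g (p i))⁻¹) (fun i => -z (p i))
  have hshift : ∀ k < n + 1, ∀ i ≤ n + 2,
      p (insertIndex k i) = insertIndex (k + 1) (rotateIndex (n + 2) i) := by
    intro k hk i hi
    simp only [hp, insertIndex, rotateIndex]
    grind
  have hlast : ∀ i ≤ n + 2,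
      p (insertIndex (n + 1) i) = rotateIndex (n + 2) (rotateIndex (n + 2) i) := by
    intro i hi
    simp only [hp, insertIndex, rotateIndex]
    grind
  have hterm : ∀ k ∈ Finset.range (n + 1),
      cyc M (n + 2) (fun i => (g (p (insertIndex k i)))⁻¹) (fun i => -z (p (insertIndex k i))) =
      cyc M (n + 2) (fun i => g (insertIndex (k + 1) i)) (fun i => z (insertIndex (k + 1) i)) := by
    intro k hk
    have hk' := Finset.mem_range.1 hk
    rw [← cyc_neg_rotate hM hS (n + 1) (fun i => g (insertIndex (k + 1) i))
      (fun i => z (insertIndex (k + 1) i)) ((sum_insertIndex (by omega) z).trans hz)]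
    exact cyc_congr M (fun i hi => by rw [hshift k hk' i hi]) (fun i hi => by rw [hshift k hk' i hi])
  have hend : cyc M (n + 2) (fun i => (g (p (insertIndex (n + 1) i)))⁻¹)
      (fun i => -z (p (insertIndex (n + 1) i))) =
      cyc M (n + 2) (fun i => g (rotateIndex (n + 2) i)) (fun i => z (rotateIndex (n + 2) i)) := by
    rw [← cyc_neg_rotate hM hS (n + 1) (fun i => g (rotateIndex (n + 2) i))
      (fun i => z (rotateIndex (n + 2) i)) ((sum_rotateIndex (n + 2) z).trans hz)]
    exact cyc_congr M (fun i hi => by rw [hlast i hi]) (fun i hi => by rw [hlast i hi])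
  have hstart : ∀ i, insertIndex 0 i = i := by
    intro i
    simp only [insertIndex]
    split_ifs <;> omega
  rw [Finset.sum_range_succ, Finset.sum_congr rfl hterm, hend] at h2
  rw [Finset.sum_range_succ'] at h1
  simp only [hstart] at h1
  linarith

/-- Proposition: every bialternal mould in `ARI(Γ)` is push-invariant. -/
theorem bialternal_pushInvariant (Γ : Type) [CommGroup Γ] [Fintype Γ]
    (M : Mould Γ) (hM : IsARI M) (hbal : IsBialternal M) :
    pushM M = M := by
  obtain ⟨hA, hS, hE⟩ := hbal
  funext m σ x
  match m, σ, x with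
  | 0, σ, x => rw [hM, pushM, hM]
  | 1, σ, x =>
    have := hE (σ 0) (x 0)
    have hσ : σ = fun _ => σ 0 := funext fun i => by rw [Subsingleton.elim i 0]
    have hx : x = fun _ => x 0 := funext fun i => by rw [Subsingleton.elim i 0]
    rw [hσ, hx, this]
    simp [pushM, extG, extQ]
  | n + 2, σ, x =>
    have key := cyc_rotate hA hS n
      (fun i => if i = 0 then extG σ (n + 1) else if i = 1 then 1 else extG σ (i - 2))
      (fun i => if i = 0 then extQ x (n + 1) else
        if i = 1 then -∑ j ∈ Finset.range (n + 2), extQ x j else extQ x (i - 2)) (by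
          rw [Finset.sum_range_succ', Finset.sum_range_succ', Finset.sum_range_succ _ (n + 1)]
          simp)
    have hpush : pushM M (n + 2) σ x = cyc M (n + 2)
        (fun i => if i = 0 then extG σ (n + 1) else if i = 1 then 1 else extG σ (i - 2))
        (fun i => if i = 0 then extQ x (n + 1) else
          if i = 1 then -∑ j ∈ Finset.range (n + 2), extQ x j else extQ x (i - 2)) := by
      unfold pushM cyc
      congr 1
      · funext i
        by_cases hi : i.val = 0 <;> simp [hi]
      · funext i
        by_cases hi : i.val = 0 <;> simp [hi]
    rw [hpush, ← key]
    unfold cyc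
    congr 1
    · funext i
      by_cases hi : i.val = n + 1
      · simp [rotateIndex, extG, show i = ⟨n + 1, by omega⟩ from Fin.ext hi]
      · simp [hi, rotateIndex, extG]
    · funext i
      by_cases hi : i.val = n + 1
      · simp [rotateIndex, extQ, show i = ⟨n + 1, by omega⟩ from Fin.ext hi]
      · simp [hi, rotateIndex, extQ]

end KVMould
end

section
/- Proposition: If M ∈ ARI(Γ) is bialternal and its depth-1 component vanishes (M^1 = 0), then swap(M) is pus-neutral: for all m ≥ 1 and all σ_1,…,σ_m ∈ Γ, Σ_{i∈ℤ/mℤ} swap(M)^m(v_{i+1},…,v_{i+m} ; σ_{i+1},…,σ_{i+m}) = 0 (indices mod m). -/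
namespace KVMould

variable {Γ : Type} [CommGroup Γ]

/-! ### Shuffles of lists -/

/-- The list of all shuffles of two lists. -/
def listShuffles {A : Type*} : List A → List A → List (List A)
  | [], v => [v]
  | a :: u, [] => [a :: u]
  | a :: u, b :: v =>
      (listShuffles u (b :: v)).map (List.cons a) ++ (listShuffles (a :: u) v).map (List.cons b)
termination_by u v => u.length + v.length

/-- The sum of a function over all shuffles of two lists. -/
def shuffleSum {A : Type*} (f : List A → ℚ) (u v : List A) : ℚ :=
  ((listShuffles u v).map f).sum

section Lists

variable {A B : Type*}

lemma shuffleSum_nil_left (f : List A → ℚ) (v : List A) : shuffleSum f [] v = f v := by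
  simp [shuffleSum, listShuffles]

lemma shuffleSum_nil_right (f : List A → ℚ) (u : List A) : shuffleSum f u [] = f u := by
  cases u <;> simp [shuffleSum, listShuffles]

lemma shuffleSum_cons_cons (f : List A → ℚ) (a b : A) (u v : List A) :
    shuffleSum f (a :: u) (b :: v) =
      shuffleSum (fun l => f (a :: l)) u (b :: v) +
        shuffleSum (fun l => f (b :: l)) (a :: u) v := by
  simp [shuffleSum, listShuffles, Function.comp_def]

lemma listShuffles_map (w : A → B) (u v : List A) :
    listShuffles (u.map w) (v.map w) = (listShuffles u v).map (List.map w) := by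
  induction u, v using listShuffles.induct with
  | case1 v => simp [listShuffles]
  | case2 a u => simp [listShuffles]
  | case3 a u b v ih₁ ih₂ =>
    simp only [List.map_cons] at ih₁ ih₂
    simp [listShuffles, ih₁, ih₂, Function.comp_def]

lemma mem_listShuffles_iff (P : A → Bool) (u v l : List A)
    (hu : ∀ a ∈ u, P a = true) (hv : ∀ a ∈ v, P a = false) :
    l ∈ listShuffles u v ↔ l.filter P = u ∧ l.filter (fun a => !P a) = v := by
  induction u, v using listShuffles.induct generalizing l with
  | case1 v =>
    simp only [listShuffles, List.mem_singleton]
    constructor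
    · rintro rfl
      exact ⟨by simpa [List.filter_eq_nil_iff] using hv, by simpa [List.filter_eq_self] using hv⟩
    · rintro ⟨h₁, h₂⟩
      rw [← h₂, eq_comm, List.filter_eq_self]
      simpa [List.filter_eq_nil_iff] using h₁
  | case2 a u =>
    simp only [listShuffles, List.mem_singleton]
    constructor
    · rintro rfl
      exact ⟨List.filter_eq_self.2 hu, by simpa [List.filter_eq_nil_iff] using hu⟩
    · rintro ⟨h₁, h₂⟩
      rw [← h₁, eq_comm, List.filter_eq_self]
      simpa [List.filter_eq_nil_iff] using h₂
  | case3 a u b v ih₁ ih₂ =>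
    have ha : P a = true := hu a (by simp)
    have hb : P b = false := hv b (by simp)
    have ih₁' := fun l => ih₁ l (fun c hc => hu c (by simp [hc])) hv
    have ih₂' := fun l => ih₂ l hu (fun c hc => hv c (by simp [hc]))
    simp only [listShuffles, List.mem_append, List.mem_map, ih₁', ih₂']
    constructor
    · rintro (⟨l, ⟨h₁, h₂⟩, rfl⟩ | ⟨l, ⟨h₁, h₂⟩, rfl⟩)
      · simp [ha, h₁, h₂]
      · simp [hb, h₁, h₂]
    · rcases l with _ | ⟨c, l⟩
      · simp
      · cases hc : P c
        · simp only [List.filter_cons, hc]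
          rintro ⟨h₁, h₂⟩
          simp at h₁ h₂
          exact Or.inr ⟨l, ⟨h₁, h₂.2⟩, by rw [h₂.1]⟩
        · simp only [List.filter_cons, hc]
          rintro ⟨h₁, h₂⟩
          simp at h₁ h₂
          exact Or.inl ⟨l, ⟨h₁.2, h₂⟩, by rw [h₁.1]⟩

lemma nodup_listShuffles (P : A → Bool) (u v : List A)
    (hu : ∀ a ∈ u, P a = true) (hv : ∀ a ∈ v, P a = false) :
    (listShuffles u v).Nodup := by
  induction u, v using listShuffles.induct with
  | case1 v => simp [listShuffles]
  | case2 a u => simp [listShuffles]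
  | case3 a u b v ih₁ ih₂ =>
    have ha : P a = true := hu a (by simp)
    have hb : P b = false := hv b (by simp)
    have hab : a ≠ b := by
      rintro rfl
      simp [ha] at hb
    rw [listShuffles, List.nodup_append]
    refine ⟨(ih₁ (fun c hc => hu c (by simp [hc])) hv).map (List.cons_injective),
      (ih₂ hu (fun c hc => hv c (by simp [hc]))).map (List.cons_injective), ?_⟩
    simp only [List.mem_map]
    rintro _ ⟨l, -, rfl⟩ _ ⟨l', -, rfl⟩ h
    exact hab (List.cons.inj h).1

/-- Moving a letter to the front modulo shuffles. -/
lemma apply_reverse_append_cons {f : List A → ℚ} {m : ℕ}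
    (hf : ∀ u v : List A, u ≠ [] → v ≠ [] → u.length + v.length = m → shuffleSum f u v = 0)
    (u : List A) (x : A) (v : List A) (hm : u.length + (v.length + 1) = m) :
    f (u.reverse ++ x :: v) = (-1) ^ u.length * shuffleSum (fun l => f (x :: l)) u v := by
  induction u generalizing x v with
  | nil => simp [shuffleSum_nil_left]
  | cons a u ih =>
    have h := hf (a :: u) (x :: v) (by simp) (by simp) (by simpa using hm)
    rw [shuffleSum_cons_cons] at h
    have := ih a (x :: v) (by simp only [List.length_cons] at hm ⊢; omega)
    simp only [List.reverse_cons, List.append_assoc, List.singleton_append, this,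
      List.length_cons, pow_succ]
    linear_combination (-1) ^ u.length * h

/-- The antipode identity of the shuffle algebra. -/
lemma sum_neg_one_pow_mul_shuffleSum (n : ℕ) (g : List A → ℚ) (l : List A)
    (hl : l.length = n + 1) :
    ∑ i ∈ Finset.range (n + 2),
      (-1) ^ i * shuffleSum g (l.drop i).reverse (l.take i) = 0 := by
  induction n generalizing g l with
  | zero =>
    obtain ⟨a, rfl⟩ := List.length_eq_one_iff.1 hl
    simp [Finset.sum_range_succ, shuffleSum_nil_left, shuffleSum_nil_right]
  | succ n ih =>
    obtain ⟨a, t, rfl⟩ := List.exists_cons_of_length_eq_add_one hl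
    obtain ⟨t', b, hb⟩ := List.eq_nil_or_concat' (a :: t) |>.resolve_left (by simp)
    have ht : t.length = n + 1 := by simpa using hl
    have ht' : t'.length = n + 1 := by
      have := congrArg List.length hb
      simp at this
      omega
    have hdrop : ∀ i ≤ n + 1, ((a :: t).drop i).reverse = b :: (t'.drop i).reverse := by
      intro i hi
      rw [hb, List.drop_append_of_le_length (by omega)]
      simp
    have htake : ∀ i ≤ n + 1, (a :: t).take i = t'.take i := by
      intro i hi
      rw [hb, List.take_append_of_le_length (by omega)]
    have hmid : ∀ i ≤ n,
        shuffleSum g ((a :: t).drop (i + 1)).reverse ((a :: t).take (i + 1)) =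
          shuffleSum (fun l => g (b :: l)) (t'.drop (i + 1)).reverse (t'.take (i + 1)) +
            shuffleSum (fun l => g (a :: l)) (t.drop i).reverse (t.take i) := by
      intro i hi
      have h₁ := hdrop (i + 1) (by omega)
      have h₂ := htake (i + 1) (by omega)
      rw [h₁, List.take_succ_cons, shuffleSum_cons_cons, ← List.take_succ_cons, h₂, ← h₁,
        List.drop_succ_cons]
    have h₀ : shuffleSum g ((a :: t).drop 0).reverse ((a :: t).take 0) =
        shuffleSum (fun l => g (b :: l)) (t'.drop 0).reverse (t'.take 0) := by
      rw [hdrop 0 (by omega)]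
      simp [shuffleSum_nil_right]
    have hlast : shuffleSum g ((a :: t).drop (n + 2)).reverse ((a :: t).take (n + 2)) =
        shuffleSum (fun l => g (a :: l)) (t.drop (n + 1)).reverse (t.take (n + 1)) := by
      simp [← ht, shuffleSum_nil_left]
    have hB := ih (fun l => g (b :: l)) t' ht'
    have hA := ih (fun l => g (a :: l)) t ht
    rw [Finset.sum_range_succ'] at hB
    rw [Finset.sum_range_succ] at hA
    rw [Finset.sum_range_succ', Finset.sum_range_succ, h₀, hlast,
      Finset.sum_congr rfl fun i hi => by
        rw [hmid i (by have := Finset.mem_range.1 hi; omega), mul_add],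
      Finset.sum_add_distrib]
    simp only [pow_succ, mul_neg, mul_one, neg_mul, Finset.sum_neg_distrib] at hA hB ⊢
    linear_combination hB - hA

/-- A function vanishing on shuffles of nonempty lists of total length at least `2` vanishes on
sums of cyclic rotations. -/
lemma sum_rotate_eq_zero {f : List A → ℚ} {m : ℕ}
    (hf : ∀ u v : List A, u ≠ [] → v ≠ [] → u.length + v.length = m → shuffleSum f u v = 0)
    (hm : 2 ≤ m) (l : List A) (hl : l.length = m) :
    ∑ i ∈ Finset.range m, f (l.rotate i) = 0 := by
  obtain ⟨n, rfl⟩ : ∃ n, m = n + 2 := ⟨m - 2, by omega⟩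
  obtain ⟨x, y, rfl⟩ := List.exists_cons_of_length_eq_add_one hl
  have hy : y.length = n + 1 := by simpa using hl
  have hrot : ∀ i ≤ n + 1, (x :: y).rotate (i + 1) = y.drop i ++ x :: y.take i := by
    intro i hi
    rw [List.rotate_cons_succ, List.rotate_eq_drop_append_take (by simp; omega),
      List.drop_append_of_le_length (by omega), List.take_append_of_le_length (by omega)]
    simp
  have hterm : ∀ i ∈ Finset.range (n + 2), f ((x :: y).rotate (i + 1)) =
      (-1) ^ (n + 1) *
        ((-1) ^ i * shuffleSum (fun l => f (x :: l)) (y.drop i).reverse (y.take i)) := by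
    intro i hi
    have hi : i ≤ n + 1 := by have := Finset.mem_range.1 hi; omega
    have h := apply_reverse_append_cons hf (y.drop i).reverse x (y.take i)
      (by simp [hy]; omega)
    rw [hrot i hi]
    rw [List.reverse_reverse] at h
    rw [h, ← mul_assoc, ← pow_add]
    congr 1
    simp only [List.length_reverse, List.length_drop, hy]
    rw [show n + 1 + i = (n + 1 - i) + 2 * i by omega, pow_add _ _ (2 * i), pow_mul]
    simp
  have hshift : ∑ i ∈ Finset.range (n + 2), f ((x :: y).rotate i) =
      ∑ i ∈ Finset.range (n + 2), f ((x :: y).rotate (i + 1)) := by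
    rw [Finset.sum_range_succ', Finset.sum_range_succ (n := n + 1)]
    congr 2
    rw [List.rotate_zero, ← hl, List.rotate_length]
  rw [hshift, Finset.sum_congr rfl hterm, ← Finset.mul_sum,
    sum_neg_one_pow_mul_shuffleSum n _ y hy, mul_zero]

end Lists

/-! ### Shuffle permutations and list shuffles -/

lemma mem_shuffles_iff (p q : ℕ) (τ : Equiv.Perm (Fin (p + q))) :
    τ ∈ shuffles p q ↔
      List.ofFn τ ∈ listShuffles (List.ofFn (Fin.castAdd q)) (List.ofFn (Fin.natAdd p)) := by
  rw [mem_listShuffles_iff (fun i : Fin (p + q) => decide (i.val < p))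
    _ _ _ (by simp [List.mem_ofFn]) (by simp [List.mem_ofFn])]
  have key : ∀ (P : Fin (p + q) → Bool) (u : List (Fin (p + q))),
      u.Pairwise (· < ·) → (∀ i, i ∈ u ↔ P i = true) →
      ((∀ i j : Fin (p + q), i < j → P i = true → P j = true → τ⁻¹ i < τ⁻¹ j) ↔
        (List.ofFn τ).filter P = u) := by
    intro P u hu hmem
    constructor
    · intro h
      have hpw : ((List.ofFn τ).filter P).Pairwise (· < ·) := by
        rw [List.pairwise_filter, List.pairwise_ofFn]
        intro i j hij hi hj
        by_contra hlt
        rcases (not_lt.1 hlt).lt_or_eq with h' | h'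
        · have := h _ _ h' hj hi
          simp at this
          exact absurd this hij.not_gt
        · exact hij.ne' (τ.injective h')
      refine List.Perm.eq_of_pairwise (fun a b _ _ h₁ h₂ => absurd h₁ h₂.not_gt) hpw hu ?_
      rw [List.perm_ext_iff_of_nodup (hpw.imp fun h => h.ne) (hu.imp fun h => h.ne)]
      intro i
      simp [hmem, List.mem_ofFn, τ.surjective i]
    · rintro rfl i j hij hi hj
      rw [List.pairwise_filter, List.pairwise_ofFn] at hu
      by_contra hlt
      rcases (not_lt.1 hlt).lt_or_eq with h' | h'
      · have := hu h' (by simpa using hj) (by simpa using hi)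
        simp at this
        exact absurd this hij.not_gt
      · exact hij.ne' (τ⁻¹.injective h')
  rw [← key _ (List.ofFn (Fin.castAdd q)) (List.pairwise_ofFn.2 fun _ _ h => h) ?_,
    ← key _ _ (by simp [List.pairwise_ofFn]) ?_]
  · simp only [shuffles, Finset.mem_filter, Finset.mem_univ, true_and, decide_eq_true_eq,
      Bool.not_eq_true', decide_eq_false_iff_not, not_lt]
    refine and_congr ⟨fun h i j hij _ hj => h i j hij hj,
      fun h i j hij hj => h i j hij (by omega) hj⟩ ⟨fun h i j hij hi _ => h i j hij hi,
      fun h i j hij hi => h i j hij hi (by omega)⟩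
  · intro i
    simp only [List.mem_ofFn, Bool.not_eq_true', decide_eq_false_iff_not, not_lt]
    exact ⟨by rintro ⟨j, rfl⟩; simp, fun h => ⟨⟨i - p, by omega⟩, by ext; simp; omega⟩⟩
  · intro i
    simp only [List.mem_ofFn, decide_eq_true_eq]
    exact ⟨by rintro ⟨j, rfl⟩; simp, fun h => ⟨⟨i, h⟩, by ext; simp⟩⟩

lemma sum_shuffles_eq_shuffleSum {A : Type*} (f : List A → ℚ) (p q : ℕ) (w : Fin (p + q) → A) :
    ∑ τ ∈ shuffles p q, f (List.ofFn fun i => w (τ i)) =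
      shuffleSum f (List.ofFn fun i => w (Fin.castAdd q i))
        (List.ofFn fun i => w (Fin.natAdd p i)) := by
  set u : List (Fin (p + q)) := List.ofFn (Fin.castAdd q) with hu
  set v : List (Fin (p + q)) := List.ofFn (Fin.natAdd p) with hv
  let P : Fin (p + q) → Bool := fun i => decide (i.val < p)
  have hPu : ∀ i ∈ u, P i = true := by simp [P, hu, List.mem_ofFn]
  have hPv : ∀ i ∈ v, P i = false := by simp [P, hv, List.mem_ofFn]
  have hw : shuffleSum f (List.ofFn fun i => w (Fin.castAdd q i))
      (List.ofFn fun i => w (Fin.natAdd p i)) =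
      ∑ l ∈ (listShuffles u v).toFinset, f (l.map w) := by
    rw [List.sum_toFinset _ (nodup_listShuffles P u v hPu hPv)]
    have h₁ : (List.ofFn fun i => w (Fin.castAdd q i)) = u.map w := by
      simp [hu, List.map_ofFn, Function.comp_def]
    have h₂ : (List.ofFn fun i => w (Fin.natAdd p i)) = v.map w := by
      simp [hv, List.map_ofFn, Function.comp_def]
    rw [h₁, h₂, shuffleSum, listShuffles_map, List.map_map]
    rfl
  rw [hw]
  refine Finset.sum_bij (fun τ _ => List.ofFn τ) ?_ ?_ ?_ ?_
  · intro τ hτ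
    exact List.mem_toFinset.2 ((mem_shuffles_iff p q τ).1 hτ)
  · intro τ _ τ' _ h
    exact Equiv.coe_fn_injective (List.ofFn_injective h)
  · intro l hl
    rw [List.mem_toFinset] at hl
    obtain ⟨h₁, h₂⟩ := (mem_listShuffles_iff P u v l hPu hPv).1 hl
    have hperm : l.Perm (List.finRange (p + q)) := by
      have h := List.filter_append_perm P l
      rw [h₁, h₂] at h
      refine h.symm.trans (List.Perm.of_eq ?_)
      rw [← List.ofFn_id, List.ofFn_add]
      simp [hu, hv]
      rfl
    have hlen : l.length = p + q := by simpa using hperm.length_eq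
    have hnd : l.Nodup := hperm.nodup_iff.2 (List.nodup_finRange _)
    let t : Fin (p + q) → Fin (p + q) := fun i => l.get (i.cast hlen.symm)
    have ht : Function.Injective t := fun i j h => by
      simpa using (List.nodup_iff_injective_get.1 hnd) h
    have hofFn : List.ofFn t = l := by
      apply List.ext_get (by simp [hlen])
      intro n _ _
      simp [t]
    refine ⟨Equiv.ofBijective t (Finite.injective_iff_bijective.1 ht), ?_, by simpa using hofFn⟩
    rw [mem_shuffles_iff]
    simpa [hofFn] using hl
  · intro τ _
    simp [List.map_ofFn, Function.comp_def]

/-- In depth at least `2`, an alternal mould has vanishing cyclic sums. -/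
lemma IsAlternal.sum_cyclic_eq_zero {N : Mould Γ} (hN : IsAlternal N) {m : ℕ} (hm : 2 ≤ m)
    (σ : Fin m → Γ) (v : Fin m → ℚ) :
    ∑ i ∈ Finset.range m,
      N m (fun j => extG σ ((i + j.val) % m)) (fun j => extQ v ((i + j.val) % m)) = 0 := by
  let f : List (Γ × ℚ) → ℚ := fun l =>
    N m (fun i => (l.getD i (1, 0)).1) (fun i => (l.getD i (1, 0)).2)
  have hf : ∀ a b : List (Γ × ℚ), a ≠ [] → b ≠ [] → a.length + b.length = m →
      shuffleSum f a b = 0 := by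
    rintro a b ha hb rfl
    have h := sum_shuffles_eq_shuffleSum f a.length b.length (Fin.append a.get b.get)
    simp only [Fin.append_left, Fin.append_right, List.ofFn_get] at h
    rw [← h, ← hN a.length b.length (List.length_pos_iff.2 ha) (List.length_pos_iff.2 hb)
      (fun i => (Fin.append a.get b.get i).1) (fun i => (Fin.append a.get b.get i).2)]
    refine Finset.sum_congr rfl fun τ _ => ?_
    simp [f]
  rw [← sum_rotate_eq_zero hf hm (List.ofFn fun i => (σ i, v i)) (by simp)]
  refine Finset.sum_congr rfl fun i _ => ?_
  have hget : ∀ j : Fin m, ((List.ofFn fun i => (σ i, v i)).rotate i).getD j (1, 0) =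
      (extG σ ((i + j.val) % m), extQ v ((i + j.val) % m)) := by
    intro j
    have hlt : (i + j.val) % m < m := Nat.mod_lt _ (by omega)
    rw [List.getD_eq_getElem _ _ (by simp), List.getElem_rotate]
    simp [extG, extQ, hlt, add_comm]
  simp only [f, hget]

/-- Proposition: if `M ∈ ARI(Γ)` is bialternal with vanishing depth-1
component, then `swap(M)` is pus-neutral. -/
theorem bialternal_swap_pusNeutral (Γ : Type) [CommGroup Γ] [Fintype Γ]
    (M : Mould Γ) (hM : IsARI M) (hbal : IsBialternal M)
    (h1 : ∀ σ x, M 1 σ x = 0) :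
    IsPusNeutral (swapM M) := by
  intro m hm σ v
  rcases hm.eq_or_lt with rfl | hm
  · simp [swapM, h1]
  · exact hbal.2.1.sum_cyclic_eq_zero hm σ v

end KVMould
end

section
/- Lemma: Let M ∈ ARI(Γ) be bialternal, let m ≥ 2, and let σ_1,…,σ_m ∈ Γ with σ_1σ_2⋯σ_m = 1. Then ũ(M)^m(x_1,…,x_m ; σ_1,…,σ_m) = ũ(M)^m(−x_2,…,−x_m,−x_1 ; σ_2^{−1},…,σ_m^{−1},σ_1^{−1}). -/
namespace KVMould

variable {Γ : Type} [CommGroup Γ]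

open Finset in
/-- Permutations `τ` for which `τ⁻¹` decreases on `{0,…,k-1}` and increases on `{k,…,n-1}`. -/
def valleyPerms (n k : ℕ) : Finset (Equiv.Perm (Fin n)) :=
  univ.filter fun τ =>
    (∀ i j : Fin n, i.val < j.val → j.val < k → τ⁻¹ j < τ⁻¹ i) ∧
    (∀ i j : Fin n, i.val < j.val → k ≤ i.val → τ⁻¹ i < τ⁻¹ j)

theorem mem_valleyPerms {n k : ℕ} {τ : Equiv.Perm (Fin n)} : τ ∈ valleyPerms n k ↔
    (∀ i j : Fin n, i.val < j.val → j.val < k → τ⁻¹ j < τ⁻¹ i) ∧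
    (∀ i j : Fin n, i.val < j.val → k ≤ i.val → τ⁻¹ i < τ⁻¹ j) := by
  simp [valleyPerms]

/-- The permutation of `Fin (p + q)` reversing the first `p` entries. -/
def revFirst (p q : ℕ) : Equiv.Perm (Fin (p + q)) :=
  Function.Involutive.toPerm
    (fun i => if i.val < p then ⟨p - 1 - i.val, by omega⟩ else i)
    (by
      intro i
      ext
      by_cases h : i.val < p
      · have : p - 1 - i.val < p := by omega
        simp only [h, this, if_true]
        omega
      · simp [h])

theorem revFirst_val (p q : ℕ) (i : Fin (p + q)) :
    (revFirst p q i).val = if i.val < p then p - 1 - i.val else i.val := by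
  change (if i.val < p then (⟨p - 1 - i.val, _⟩ : Fin (p + q)) else i).val = _
  split_ifs <;> rfl

theorem revFirst_mul_self (p q : ℕ) : revFirst p q * revFirst p q = 1 := by
  ext i
  simp only [Equiv.Perm.mul_apply, revFirst_val, Equiv.Perm.one_apply]
  split_ifs <;> omega

theorem revFirst_inv (p q : ℕ) : (revFirst p q)⁻¹ = revFirst p q :=
  inv_eq_of_mul_eq_one_left (revFirst_mul_self p q)

theorem revFirst_mul_mem_valleyPerms {p q : ℕ} {τ : Equiv.Perm (Fin (p + q))}
    (hτ : τ ∈ shuffles p q) : revFirst p q * τ ∈ valleyPerms (p + q) p := by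
  simp only [shuffles, Finset.mem_filter, Finset.mem_univ, true_and] at hτ
  rw [mem_valleyPerms, mul_inv_rev, revFirst_inv]
  constructor
  · intro i j hij hj
    apply hτ.1 <;> simp only [revFirst_val] <;> split_ifs <;> omega
  · intro i j hij hi
    apply hτ.2 <;> simp only [revFirst_val] <;> split_ifs <;> omega

theorem revFirst_mul_mem_shuffles {p q : ℕ} {τ : Equiv.Perm (Fin (p + q))}
    (hτ : τ ∈ valleyPerms (p + q) p) : revFirst p q * τ ∈ shuffles p q := by
  rw [mem_valleyPerms] at hτ
  simp only [shuffles, Finset.mem_filter, Finset.mem_univ, true_and]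
  rw [mul_inv_rev, revFirst_inv]
  constructor
  · intro i j hij hj
    apply hτ.1 <;> simp only [revFirst_val] <;> split_ifs <;> omega
  · intro i j hij hi
    apply hτ.2 <;> simp only [revFirst_val] <;> split_ifs <;> omega

theorem IsAlternal.sum_valleyPerms {Δ : Type} {M : Mould Δ} (hM : IsAlternal M) {n k : ℕ}
    (hk : 1 ≤ k) (hkn : k < n) (σ : Fin n → Δ) (x : Fin n → ℚ) :
    ∑ τ ∈ valleyPerms n k, M n (fun i => σ (τ i)) (fun i => x (τ i)) = 0 := by
  obtain ⟨q, rfl⟩ := Nat.exists_eq_add_of_le hkn.le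
  rw [← hM k q hk (by omega) (fun i => σ (revFirst k q i)) (fun i => x (revFirst k q i))]
  refine Finset.sum_bij' (fun τ _ => revFirst k q * τ) (fun τ _ => revFirst k q * τ)
    (fun τ h => revFirst_mul_mem_shuffles h) (fun τ h => revFirst_mul_mem_valleyPerms h)
    ?_ ?_ ?_
  · intro τ _
    rw [← mul_assoc, revFirst_mul_self, one_mul]
  · intro τ _
    rw [← mul_assoc, revFirst_mul_self, one_mul]
  · intro τ _
    have h (i : Fin (k + q)) : revFirst k q ((revFirst k q * τ) i) = τ i := by
      rw [← Equiv.Perm.mul_apply, ← mul_assoc, revFirst_mul_self, one_mul]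
    simp only [h]

theorem valleyPerms_zero (n : ℕ) : valleyPerms n 0 = {1} := by
  ext τ
  rw [mem_valleyPerms, Finset.mem_singleton]
  constructor
  · rintro ⟨-, h⟩
    have hmono : StrictMono (τ⁻¹ : Equiv.Perm (Fin n)) := fun i j hij => h i j hij (Nat.zero_le _)
    have hid : (τ⁻¹ : Equiv.Perm (Fin n)) = 1 :=
      Equiv.ext fun i => congrFun ((hmono.range_inj strictMono_id).mp
        (by rw [(τ⁻¹ : Equiv.Perm (Fin n)).surjective.range_eq, Set.range_id])) i
    exact inv_eq_one.mp hid
  · rintro rfl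
    exact ⟨fun _ _ _ h => absurd h (Nat.not_lt_zero _), fun i j h _ => by simpa using h⟩

theorem valleyPerms_self (n : ℕ) : valleyPerms n n = {Fin.revPerm} := by
  ext τ
  rw [mem_valleyPerms, Finset.mem_singleton]
  constructor
  · rintro ⟨h, -⟩
    have hmono : StrictMono (fun i => (τ⁻¹ : Equiv.Perm (Fin n)) (Fin.rev i)) :=
      fun i j hij => h _ _ (Fin.rev_lt_rev.mpr hij) (Fin.is_lt _)
    have hsurj : Function.Surjective (fun i => (τ⁻¹ : Equiv.Perm (Fin n)) (Fin.rev i)) :=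
      (τ⁻¹ : Equiv.Perm (Fin n)).surjective.comp Fin.rev_surjective
    have hid := (hmono.range_inj strictMono_id).mp
      (by rw [hsurj.range_eq, Set.range_id])
    refine Equiv.ext fun i => ?_
    have := congrFun hid i
    simp only [id] at this
    rw [Equiv.Perm.inv_eq_iff_eq] at this
    rw [Fin.revPerm_apply, this]
  · rintro rfl
    refine ⟨fun i j h _ => ?_, fun i _ _ h => absurd i.is_lt (not_lt.mpr h)⟩
    exact Fin.rev_lt_rev.mpr h

/-- Each permutation cancels in the alternating sum over `k` of `valleyPerms (n + 1) k`: it can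
only occur for `k = τ 0` and `k = τ 0 + 1`, and it occurs for both or for neither. -/
theorem sum_neg_one_pow_valleyPerms {n : ℕ} (τ : Equiv.Perm (Fin (n + 1))) :
    ∑ k ∈ Finset.range (n + 2), (if τ ∈ valleyPerms (n + 1) k then (-1 : ℚ) ^ k else 0) = 0 := by
  have hinv : τ⁻¹ (τ 0) = 0 := Equiv.Perm.inv_eq_iff_eq.mpr rfl
  have hmin (i : Fin (n + 1)) (hi : i ≠ τ 0) : τ⁻¹ (τ 0) < τ⁻¹ i := by
    rw [hinv, Fin.pos_iff_ne_zero]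
    intro h
    exact hi (Equiv.Perm.inv_eq_iff_eq.mp h)
  have hmin' (i : Fin (n + 1)) : ¬ τ⁻¹ i < τ⁻¹ (τ 0) := by
    rw [hinv]
    exact Fin.not_lt_zero _
  have hmem : τ ∈ valleyPerms (n + 1) (τ 0).val ↔ τ ∈ valleyPerms (n + 1) ((τ 0).val + 1) := by
    simp only [mem_valleyPerms]
    constructor
    · rintro ⟨h₁, h₂⟩
      refine ⟨fun i j hij hj => ?_, fun i j hij hi => h₂ i j hij (by omega)⟩
      by_cases h : j = τ 0
      · subst h
        exact hmin i (fun h => by simp [h] at hij)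
      · exact h₁ i j hij (lt_of_le_of_ne (by omega) (fun h' => h (Fin.ext h')))
    · rintro ⟨h₁, h₂⟩
      refine ⟨fun i j hij hj => h₁ i j hij (by omega), fun i j hij hi => ?_⟩
      by_cases h : i = τ 0
      · subst h
        exact hmin j (fun h => by simp [h] at hij)
      · exact h₂ i j hij (lt_of_le_of_ne hi (fun h' => h (Fin.ext h'.symm)))
  have hlt := (τ 0).is_lt
  have hne : (τ 0).val ≠ (τ 0).val + 1 := by omega
  rw [← Finset.sum_subset (s₁ := {(τ 0).val, (τ 0).val + 1})]
  · rw [Finset.sum_pair hne]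
    by_cases h : τ ∈ valleyPerms (n + 1) ((τ 0).val + 1)
    · rw [if_pos h, if_pos (hmem.mpr h), pow_succ]
      ring
    · rw [if_neg h, if_neg (fun h' => h (hmem.mp h')), add_zero]
  · intro k hk
    simp only [Finset.mem_insert, Finset.mem_singleton] at hk
    rw [Finset.mem_range]
    omega
  · intro k hk hk'
    simp only [Finset.mem_insert, Finset.mem_singleton, not_or] at hk'
    rw [Finset.mem_range] at hk
    refine if_neg fun h => ?_
    rw [mem_valleyPerms] at h
    rcases lt_or_gt_of_ne hk'.1 with hlt' | hgt
    · exact hmin' ⟨(τ 0).val - 1, by omega⟩ (h.2 _ _ (by simp only; omega) (by simp only; omega))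
    · exact hmin' ⟨(τ 0).val + 1, by omega⟩ (h.1 _ _ (by simp only; omega) (by simp only; omega))

/-- Alternal moulds are invariant, up to the sign `(-1)^(m-1)`, under reversal of the
sequence of arguments. -/
theorem IsAlternal.eq_rev {Δ : Type} {M : Mould Δ} (hM : IsAlternal M) (n : ℕ)
    (σ : Fin (n + 1) → Δ) (x : Fin (n + 1) → ℚ) :
    M (n + 1) σ x = (-1) ^ n * M (n + 1) (fun i => σ i.rev) (fun i => x i.rev) := by
  have h : ∑ k ∈ Finset.range (n + 2), (-1 : ℚ) ^ k *
      ∑ τ ∈ valleyPerms (n + 1) k, M (n + 1) (fun i => σ (τ i)) (fun i => x (τ i)) = 0 := by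
    have (k : ℕ) : (-1 : ℚ) ^ k *
        ∑ τ ∈ valleyPerms (n + 1) k, M (n + 1) (fun i => σ (τ i)) (fun i => x (τ i)) =
        ∑ τ, (if τ ∈ valleyPerms (n + 1) k then (-1 : ℚ) ^ k else 0) *
          M (n + 1) (fun i => σ (τ i)) (fun i => x (τ i)) := by
      simp only [ite_mul, zero_mul]
      rw [Finset.sum_ite_mem, Finset.univ_inter, Finset.mul_sum]
    simp only [this]
    rw [Finset.sum_comm]
    refine Finset.sum_eq_zero fun τ _ => ?_
    rw [← Finset.sum_mul, sum_neg_one_pow_valleyPerms, zero_mul]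
  rw [Finset.sum_range_succ, Finset.sum_range_succ', Finset.sum_eq_zero, valleyPerms_zero,
    valleyPerms_self] at h
  · simp only [Finset.sum_singleton, Equiv.Perm.one_apply, Fin.revPerm_apply, pow_succ,
      pow_zero] at h
    linear_combination h
  · intro k hk
    rw [Finset.mem_range] at hk
    rw [hM.sum_valleyPerms (by omega) (by omega), mul_zero]

theorem prod_range_shift_eq_prod_inv (s : ℕ → Γ) (n i : ℕ) (hi : i ≤ n)
    (hs : ∏ j ∈ Finset.range (n + 2), s j = 1) :
    ∏ j ∈ Finset.range (i + 1), s (j + 1) =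
      ∏ j ∈ Finset.range (n + 1 - i), (s ((n - j + 1 + 1) % (n + 2)))⁻¹ := by
  obtain ⟨c, rfl⟩ := Nat.exists_eq_add_of_le hi
  rw [show i + c + 1 - i = c + 1 by omega,
    Finset.prod_range_succ' (fun j => (s ((i + c - j + 1 + 1) % (i + c + 2)))⁻¹)]
  have h₀ : (i + c - 0 + 1 + 1) % (i + c + 2) = 0 := Nat.mod_self _
  have h₁ : ∏ j ∈ Finset.range c, (s ((i + c - (j + 1) + 1 + 1) % (i + c + 2)))⁻¹ =
      (∏ j ∈ Finset.range c, s (i + 1 + j + 1))⁻¹ := by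
    rw [← Finset.prod_range_reflect, ← Finset.prod_inv_distrib]
    refine Finset.prod_congr rfl fun j hj => ?_
    rw [Finset.mem_range] at hj
    rw [Nat.mod_eq_of_lt (by omega)]
    congr 2
    omega
  rw [h₀, h₁]
  rw [Finset.prod_range_succ', show i + c + 1 = (i + 1) + c by omega, Finset.prod_range_add] at hs
  rw [← mul_inv, eq_inv_iff_mul_eq_one, ← mul_assoc]
  exact hs

/-- The consecutive differences of the translates by `x 0` and, in reversed order, of the negated
and cyclically shifted translates by `x 1` agree. -/
theorem extQ_sub_extQ_eq {n : ℕ} (x : Fin (n + 2) → ℚ) (i : ℕ) (hi : i ≤ n) :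
    extQ (fun j : Fin (n + 1) => extQ x (j.val + 1) - extQ x 0) i -
      extQ (fun j : Fin (n + 1) => extQ x (j.val + 1) - extQ x 0) (i + 1) =
    extQ (fun j : Fin (n + 1) =>
        -extQ x ((n - j.val + 1 + 1) % (n + 2)) + extQ x 1) (n - i) -
      extQ (fun j : Fin (n + 1) =>
        -extQ x ((n - j.val + 1 + 1) % (n + 2)) + extQ x 1) (n + 1 - i) := by
  generalize extQ x = X
  have key (j : ℕ) : extQ (fun j : Fin (n + 1) =>
      -X ((n - j.val + 1 + 1) % (n + 2)) + X 1) j =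
      if j < n + 1 then -X ((n - j + 1 + 1) % (n + 2)) + X 1 else 0 := by
    simp [extQ]
  have key' (j : ℕ) : extQ (fun j : Fin (n + 1) => X (j.val + 1) - X 0) j =
      if j < n + 1 then X (j + 1) - X 0 else 0 := by
    simp [extQ]
  rw [key, key, key', key', if_pos (show i < n + 1 by omega), if_pos (show n - i < n + 1 by omega)]
  rw [show n - (n - i) + 1 + 1 = i + 2 by omega]
  rcases hi.eq_or_lt with rfl | hlt
  · rw [if_neg (lt_irrefl (i + 1)), Nat.mod_self]
    rcases Nat.eq_zero_or_pos i with rfl | hpos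
    · simp
      ring
    · rw [if_pos (by omega), Nat.mod_eq_of_lt (by omega),
        show i - (i + 1 - i) + 1 + 1 = i + 1 by omega]
      ring
  · rw [if_pos (by omega), Nat.mod_eq_of_lt (by omega)]
    rcases Nat.eq_zero_or_pos i with rfl | hpos
    · simp
      ring
    · rw [if_pos (by omega), Nat.mod_eq_of_lt (by omega),
        show n - (n + 1 - i) + 1 + 1 = i + 1 by omega]
      ring

/-- Lemma: for a bialternal `M ∈ ARI(Γ)`, `m ≥ 2` and `σ₁⋯σₘ = 1`,
`ũ(M)^m(x₁,…,xₘ;σ₁,…,σₘ) = ũ(M)^m(−x₂,…,−xₘ,−x₁;σ₂⁻¹,…,σₘ⁻¹,σ₁⁻¹)`. -/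
theorem uTilde_cyclic_inversion (Γ : Type) [CommGroup Γ] [Fintype Γ]
    (M : Mould Γ) (hM : IsARI M) (hbal : IsBialternal M)
    (m : ℕ) (hm : 2 ≤ m) (σ : Fin m → Γ) (hσ : ∏ i, σ i = 1) (x : Fin m → ℚ) :
    uTilde M m σ x =
      uTilde M m (fun j => (extG σ ((j.val + 1) % m))⁻¹)
        (fun j => -(extQ x ((j.val + 1) % m))) := by
  obtain ⟨n, rfl⟩ := Nat.exists_eq_add_of_le' hm
  obtain ⟨hM₁, hM₂, -⟩ := hbal
  have hprod : ∏ j ∈ Finset.range (n + 2), extG σ j = 1 := by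
    rw [← hσ, Finset.prod_range]
    exact Finset.prod_congr rfl fun i _ => by simp [extG]
  simp only [uTilde, tMap, if_neg (show ¬ n + 2 ≤ 1 by omega)]
  refine Eq.trans ?_ (hM₂.eq_rev n (fun j => extG (fun j : Fin (n + 2) => (extG σ ((j.val + 1) % (n + 2)))⁻¹) (j.val + 1))
    (fun j => extQ (fun j : Fin (n + 2) => -extQ x ((j.val + 1) % (n + 2))) (j.val + 1) -
      extQ (fun j : Fin (n + 2) => -extQ x ((j.val + 1) % (n + 2))) 0)).symm
  change swapM M (n + 1) (fun j : Fin (n + 1) => extG σ (j.val + 1))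
    (fun j : Fin (n + 1) => extQ x (j.val + 1) - extQ x 0) = _
  simp only [swapM]
  refine (hM₁.eq_rev n _ _).trans ?_
  congr 2
  · funext i
    have hi := i.is_lt
    rw [Fin.val_rev, show n + 1 - (n + 1 - (i.val + 1)) = i.val + 1 by omega]
    trans ∏ j ∈ Finset.range (i.val + 1), extG σ (j + 1)
    · refine Finset.prod_congr rfl fun j hj => ?_
      rw [Finset.mem_range] at hj
      simp [extG, show j < n + 1 by omega]
    · rw [prod_range_shift_eq_prod_inv _ n i.val (by omega) hprod]
      refine Finset.prod_congr rfl fun j hj => ?_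
      rw [Finset.mem_range] at hj
      conv_rhs => rw [extG, dif_pos (show j < n + 1 by omega), extG,
        dif_pos (show (Fin.rev (⟨j, by omega⟩ : Fin (n + 1))).val + 1 < n + 2 by omega)]
      simp only [Fin.val_rev]
      rw [show n + 1 - (j + 1) = n - j by omega]
  · funext i
    have hi := i.is_lt
    simp only [Fin.val_rev]
    rw [show n + 1 - 1 - (n + 1 - (i.val + 1)) = i.val by omega,
      show n + 1 - (n + 1 - (i.val + 1)) = i.val + 1 by omega, Nat.add_sub_cancel]
    refine (extQ_sub_extQ_eq x i.val (by omega)).trans ?_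
    have h : (fun j : Fin (n + 1) => -extQ x ((n - j.val + 1 + 1) % (n + 2)) + extQ x 1) =
        fun j : Fin (n + 1) =>
          extQ (fun j : Fin (n + 2) => -extQ x ((j.val + 1) % (n + 2)))
              (n + 1 - (j.val + 1) + 1) -
            extQ (fun j : Fin (n + 2) => -extQ x ((j.val + 1) % (n + 2))) 0 := by
      funext j
      have e (k : ℕ) (hk : k < n + 2) :
          extQ (fun j : Fin (n + 2) => -extQ x ((j.val + 1) % (n + 2))) k =
            -extQ x ((k + 1) % (n + 2)) := dif_pos hk
      rw [e _ (by omega), e _ (by omega), sub_neg_eq_add, Nat.add_sub_add_right,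
        Nat.mod_eq_of_lt (show 0 + 1 < n + 2 by omega)]
    rw [h]

end KVMould
end
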